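/- arXiv:1109.5492 — 2 statements merged into one kernel-verified Lean document; each statement's English description precedes it below -/
import Mathlib

section
/- For every integer n ≥ 0, the function K̃_n has exactly M_n zeros in the slit plane ℂ∖(−∞,0] counted with multiplicity, where M_n = n if n is even and M_n = n−1 if n is odd; every zero is simple, every zero has strictly negative real part and nonzero imaginary part (so the zeros lie in the open second and third quadrants), and the zero set is closed under complex conjugation. -/
open MeasureTheory

noncomputable section

/-- Modified Bessel function of the second kind of integer order `n`, for real argument. -/
def besselK (n : ℕ) (x : ℝ) : ℝ :=
  ∫ t in Set.Ioi (0:ℝ), Real.exp (-x * Real.cosh t) * Real.cosh (n * t)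

/-- Modified Bessel function of the first kind of integer order `n`. -/
def besselI (n : ℕ) (x : ℝ) : ℝ :=
  ∑' k : ℕ, (x/2)^(n+2*k) / (Nat.factorial k * Nat.factorial (n+k))

/-- `M_n = n` for even `n`, `n-1` for odd `n`. -/
def Mn (n : ℕ) : ℕ := if Even n then n else n - 1

/-- The half-integer-order modified Bessel function `K_{n+1/2}` on the slit plane,
using the principal branch of the square root. -/
def Khalf (n : ℕ) (z : ℂ) : ℂ :=
  ((Real.pi : ℂ) / (2*z)) ^ ((1:ℂ)/2) * Complex.exp (-z) *
    ∑ k ∈ Finset.range (n+1),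
      ((n+k).factorial : ℂ) / ((k.factorial : ℂ) * ((n-k).factorial : ℂ) * (2*z)^k)

/-- The polynomial `p_n(z) = Σ_{k=0}^n [(n+k)!/(k!(n-k)!)] (2z)^{n-k}`. -/
def pPoly (n : ℕ) : Polynomial ℂ :=
  ∑ k ∈ Finset.range (n+1),
    Polynomial.C (((n+k).factorial : ℂ) / ((k.factorial : ℂ) * ((n-k).factorial : ℂ)))
      * (2 • Polynomial.X) ^ (n-k)

/-- Modified spherical Bessel function `k_n(z) = √(2/(π z)) K_{n+1/2}(z)`. -/
def sphk (n : ℕ) (z : ℂ) : ℂ := ((2:ℂ)/((Real.pi : ℂ) * z)) ^ ((1:ℂ)/2) * Khalf n z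

/-- Laplace transform. -/
def laplace (f : ℝ → ℂ) (s : ℂ) : ℂ := ∫ t in Set.Ioi (0:ℝ), Complex.exp (-s * t) * f t

/-- Convolution on `[0,∞)`. -/
def conv (f g : ℝ → ℂ) (t : ℝ) : ℂ := ∫ τ in (0:ℝ)..t, f (t - τ) * g τ

/-- The 3-D nonreflecting boundary kernel `σ_{n+1/2}` built from the roots `Z` of `p_n`. -/
def sigma3 {n : ℕ} (b c : ℝ) (Z : Fin n → ℂ) (t : ℝ) : ℂ :=
  ((c:ℂ)/(b:ℂ)^2) * ∑ j, Z j * Complex.exp ((c:ℂ) * t * Z j / b)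

/-- The 3-D nonreflecting boundary kernel `ω_{n+1/2}` built from the roots `Z` of `p_n`. -/
def omega3 {n : ℕ} (b c : ℝ) (Z : Fin n → ℂ) (t : ℝ) : ℂ :=
  -(c:ℂ)/b + ((c:ℂ)/b) * ∑ j, (Complex.exp ((c:ℂ) * t * Z j / b) - 1)

/-- The 2-D nonreflecting boundary kernel `σ_n`, built from the zeros `Z` of (the analytic
continuation of) `K_n`. -/
def sigma2 (n : ℕ) (b c : ℝ) {m : ℕ} (Z : Fin m → ℂ) (t : ℝ) : ℂ :=
  ((c:ℂ)/(b:ℂ)^2) * (∑ j, Z j * Complex.exp ((c:ℂ) * t * Z j / b)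
    + (-1:ℂ)^n * ((∫ r in Set.Ioi (0:ℝ),
        Real.exp (-c*t*r/b) / ((besselK n r)^2 + Real.pi^2 * (besselI n r)^2) : ℝ) : ℂ))

/-- The 2-D nonreflecting boundary kernel `ω_n`. -/
def omega2 (n : ℕ) (b c : ℝ) {m : ℕ} (Z : Fin m → ℂ) (t : ℝ) : ℂ :=
  -(c:ℂ)/(2*b) + ((c:ℂ)/b) * (∑ j, (Complex.exp ((c:ℂ) * t * Z j / b) - 1)
    + (-1:ℂ)^n * ((∫ r in Set.Ioi (0:ℝ),
        (1 - Real.exp (-c*t*r/b)) / (r * ((besselK n r)^2 + Real.pi^2 * (besselI n r)^2)) : ℝ) : ℂ))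

end

section

open Set Filter Topology ComplexConjugate

/-- The Macdonald function of real order `ν` on the real line. -/
noncomputable def macdonald (ν x : ℝ) : ℝ :=
  ∫ t in Ioi (0:ℝ), Real.exp (-x * Real.cosh t) * Real.cosh (ν * t)

section Macdonald

lemma Real.sq_div_two_le_cosh_sub_one (t : ℝ) : t ^ 2 / 2 ≤ Real.cosh t - 1 := by
  have h : Real.cosh t = 2 * Real.sinh (t / 2) ^ 2 + 1 := by
    have := Real.cosh_two_mul (t / 2)
    rw [mul_div_cancel₀ t two_ne_zero] at this
    rw [this, Real.cosh_sq]; ring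
  have h2 : |t / 2| ≤ |Real.sinh (t / 2)| := by
    rw [Real.abs_sinh]; exact Real.self_le_sinh_iff.2 (abs_nonneg _)
  have h3 := sq_le_sq.2 h2
  rw [h]; nlinarith

lemma Real.sinh_le_mul_cosh {y : ℝ} (hy : 0 ≤ y) : Real.sinh y ≤ y * Real.cosh y := by
  have hd : ∀ x, HasDerivAt (fun x => x * Real.cosh x - Real.sinh x) (x * Real.sinh x) x := by
    intro x
    exact (((hasDerivAt_id x).mul (Real.hasDerivAt_cosh x)).sub
      (Real.hasDerivAt_sinh x)).congr_deriv (by simp)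
  have hm : MonotoneOn (fun x => x * Real.cosh x - Real.sinh x) (Ici 0) := by
    refine monotoneOn_of_deriv_nonneg (convex_Ici 0) (by fun_prop) (by fun_prop) ?_
    intro x hx
    rw [(hd x).deriv]
    rw [interior_Ici] at hx
    exact mul_nonneg (le_of_lt hx) (Real.sinh_nonneg_iff.2 (le_of_lt hx))
  have := hm self_mem_Ici hy hy
  simp at this
  linarith

lemma exp_neg_mul_cosh_mul_exp_le {x : ℝ} (hx : 0 < x) (c t : ℝ) :
    Real.exp (-x * Real.cosh t) * Real.exp (c * t) ≤
      Real.exp ((c + 1) ^ 2 / (2 * x)) * Real.exp (-t) := by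
  rw [← Real.exp_add, ← Real.exp_add, Real.exp_le_exp]
  have h1 := Real.sq_div_two_le_cosh_sub_one t
  have h2 : (c + 1) * t - x * t ^ 2 / 2 ≤ (c + 1) ^ 2 / (2 * x) := by
    rw [le_div_iff₀ (by positivity)]
    nlinarith [sq_nonneg (x * t - (c + 1))]
  nlinarith [mul_le_mul_of_nonneg_left h1 hx.le]

lemma Real.cosh_mul_le_exp (ν : ℝ) {t : ℝ} (ht : 0 ≤ t) :
    Real.cosh (ν * t) ≤ Real.exp (|ν| * t) := by
  rw [← Real.cosh_abs, abs_mul, abs_of_nonneg ht]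
  rw [Real.cosh_eq]; have := Real.exp_le_exp.2 (show -(|ν| * t) ≤ |ν| * t by have := mul_nonneg (abs_nonneg ν) ht; linarith); linarith

lemma integrableOn_exp_neg_mul_cosh_mul {x : ℝ} (hx : 0 < x) {g : ℝ → ℝ} (hg : Continuous g)
    {C c : ℝ} (hb : ∀ t, 0 ≤ t → |g t| ≤ C * Real.exp (c * t)) :
    IntegrableOn (fun t => Real.exp (-x * Real.cosh t) * g t) (Ioi 0) := by
  have hi : IntegrableOn (fun t : ℝ => C * (Real.exp ((c + 1) ^ 2 / (2 * x)) * Real.exp (-t)))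
      (Ioi 0) := by
    have := exp_neg_integrableOn_Ioi 0 one_pos
    simp only [neg_mul, one_mul] at this
    exact (this.const_mul _).const_mul _
  refine hi.mono' (by fun_prop) ?_
  refine (ae_restrict_iff' measurableSet_Ioi).2 (ae_of_all _ fun t ht => ?_)
  have hC : 0 ≤ C := by
    have := (abs_nonneg _).trans (hb 0 le_rfl)
    simpa using this
  rw [norm_mul, Real.norm_eq_abs, Real.norm_eq_abs, Real.abs_exp]
  calc _ ≤ Real.exp (-x * Real.cosh t) * (C * Real.exp (c * t)) := by
        gcongr; exact hb t (le_of_lt ht)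
    _ = C * (Real.exp (-x * Real.cosh t) * Real.exp (c * t)) := by ring
    _ ≤ _ := mul_le_mul_of_nonneg_left (exp_neg_mul_cosh_mul_exp_le hx c t) hC

lemma tendsto_exp_neg_mul_cosh_mul {x : ℝ} (hx : 0 < x) {g : ℝ → ℝ}
    {C c : ℝ} (hb : ∀ t, 0 ≤ t → |g t| ≤ C * Real.exp (c * t)) :
    Tendsto (fun t => Real.exp (-x * Real.cosh t) * g t) atTop (𝓝 0) := by
  have hC : 0 ≤ C := by
    have := (abs_nonneg _).trans (hb 0 le_rfl)
    simpa using this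
  have hl : Tendsto (fun t : ℝ => C * (Real.exp ((c + 1) ^ 2 / (2 * x)) * Real.exp (-t)))
      atTop (𝓝 0) := by
    simpa using (Real.tendsto_exp_neg_atTop_nhds_zero.const_mul _).const_mul C
  refine squeeze_zero_norm' ?_ hl
  filter_upwards [eventually_ge_atTop 0] with t ht
  rw [norm_mul, Real.norm_eq_abs, Real.norm_eq_abs, Real.abs_exp]
  calc _ ≤ Real.exp (-x * Real.cosh t) * (C * Real.exp (c * t)) := by
        gcongr; exact hb t ht
    _ = C * (Real.exp (-x * Real.cosh t) * Real.exp (c * t)) := by ring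
    _ ≤ _ := mul_le_mul_of_nonneg_left (exp_neg_mul_cosh_mul_exp_le hx c t) hC

lemma integrableOn_macdonald (ν : ℝ) {x : ℝ} (hx : 0 < x) :
    IntegrableOn (fun t => Real.exp (-x * Real.cosh t) * Real.cosh (ν * t)) (Ioi 0) :=
  integrableOn_exp_neg_mul_cosh_mul hx (by fun_prop) (C := 1) (c := |ν|) fun t ht => by
    rw [abs_of_pos (Real.cosh_pos _), one_mul]; exact Real.cosh_mul_le_exp ν ht

lemma Real.cosh_mul_cosh_mul (ν t : ℝ) : Real.cosh t * Real.cosh (ν * t) =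
    (Real.cosh ((ν + 1) * t) + Real.cosh ((ν - 1) * t)) / 2 := by
  rw [add_mul, sub_mul, one_mul, Real.cosh_add, Real.cosh_sub]; ring

lemma Real.sinh_mul_sinh_mul (ν t : ℝ) : Real.sinh t * Real.sinh (ν * t) =
    (Real.cosh ((ν + 1) * t) - Real.cosh ((ν - 1) * t)) / 2 := by
  rw [add_mul, sub_mul, one_mul, Real.cosh_add, Real.cosh_sub]; ring

lemma integral_cosh_mul_macdonald (ν : ℝ) {x : ℝ} (hx : 0 < x) :
    ∫ t in Ioi (0:ℝ), Real.exp (-x * Real.cosh t) * (Real.cosh t * Real.cosh (ν * t)) =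
      (macdonald (ν + 1) x + macdonald (ν - 1) x) / 2 := by
  simp only [macdonald]
  rw [← integral_add (integrableOn_macdonald _ hx) (integrableOn_macdonald _ hx),
    ← integral_div]
  congr 1; ext t
  rw [Real.cosh_mul_cosh_mul]; ring

lemma hasDerivAt_macdonald (ν : ℝ) {x : ℝ} (hx : 0 < x) :
    HasDerivAt (macdonald ν) (-((macdonald (ν + 1) x + macdonald (ν - 1) x) / 2)) x := by
  rw [← integral_cosh_mul_macdonald ν hx, ← integral_neg]
  have key (y t : ℝ) : HasDerivAt (fun x => Real.exp (-x * Real.cosh t) * Real.cosh (ν * t))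
      (-(Real.exp (-y * Real.cosh t) * (Real.cosh t * Real.cosh (ν * t)))) y := by
    have h := (((hasDerivAt_id y).neg.mul_const (Real.cosh t)).exp).mul_const (Real.cosh (ν * t))
    exact h.congr_deriv (by simp; ring)
  have hint : IntegrableOn (fun t => Real.exp (-(x / 2) * Real.cosh t) *
      (Real.cosh t * Real.cosh (ν * t))) (Ioi 0) := by
    have := ((integrableOn_macdonald (ν + 1) (half_pos hx)).add
      (integrableOn_macdonald (ν - 1) (half_pos hx))).div_const 2
    refine this.congr (ae_of_all _ fun t => ?_)
    simp only [Pi.add_apply]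
    rw [Real.cosh_mul_cosh_mul]; ring
  refine (hasDerivAt_integral_of_dominated_loc_of_deriv_le
    (Ioi_mem_nhds (half_lt_self hx)) (Eventually.of_forall fun y => by fun_prop)
    (F := fun y t => Real.exp (-y * Real.cosh t) * Real.cosh (ν * t))
    (F' := fun y t => -(Real.exp (-y * Real.cosh t) * (Real.cosh t * Real.cosh (ν * t))))
    (integrableOn_macdonald ν hx) (by fun_prop)
    (ae_of_all _ fun t y hy => ?_) hint (ae_of_all _ fun t y _ => key y t)).2
  have h1 := Real.cosh_pos t
  have h2 := Real.cosh_pos (ν * t)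
  rw [norm_neg, Real.norm_of_nonneg (by positivity)]
  have : x / 2 ≤ y := le_of_lt hy
  gcongr

lemma integral_exp_neg_mul_cosh_mul_deriv {x : ℝ} (hx : 0 < x) {g g' : ℝ → ℝ} {C c : ℝ}
    (hg : ∀ t, HasDerivAt g (g' t) t) (hg' : Continuous g')
    (hb : ∀ t, 0 ≤ t → |g t| ≤ C * Real.exp (c * t))
    (hb' : ∀ t, 0 ≤ t → |g' t| ≤ C * Real.exp (c * t)) :
    x * ∫ t in Ioi (0:ℝ), Real.exp (-x * Real.cosh t) * (Real.sinh t * g t) =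
      Real.exp (-x) * g 0 + ∫ t in Ioi (0:ℝ), Real.exp (-x * Real.cosh t) * g' t := by
  have hgc : Continuous g := continuous_iff_continuousAt.2 fun t => (hg t).continuousAt
  have hd (t : ℝ) : HasDerivAt (fun t => Real.exp (-x * Real.cosh t) * g t)
      (Real.exp (-x * Real.cosh t) * g' t -
        x * (Real.exp (-x * Real.cosh t) * (Real.sinh t * g t))) t := by
    exact ((((Real.hasDerivAt_cosh t).const_mul (-x)).exp).mul (hg t)).congr_deriv (by ring)
  have i1 := integrableOn_exp_neg_mul_cosh_mul hx hg' hb'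
  have i2 : IntegrableOn (fun t => Real.exp (-x * Real.cosh t) * (Real.sinh t * g t)) (Ioi 0) := by
    refine integrableOn_exp_neg_mul_cosh_mul hx (by fun_prop) (C := C) (c := c + 1)
      fun t ht => ?_
    have h1 : |Real.sinh t| ≤ Real.exp t := by
      rw [abs_of_nonneg (Real.sinh_nonneg_iff.2 ht), Real.sinh_eq]
      have := Real.exp_pos (-t); have := Real.exp_pos t; linarith
    rw [abs_mul]
    calc _ ≤ Real.exp t * (C * Real.exp (c * t)) :=
          mul_le_mul h1 (hb t ht) (abs_nonneg _) (Real.exp_pos t).le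
      _ = C * Real.exp ((c + 1) * t) := by
        rw [add_mul, one_mul, Real.exp_add]; ring
  have h := integral_Ioi_of_hasDerivAt_of_tendsto' (fun t _ => hd t) (i1.sub (i2.const_mul x))
    (tendsto_exp_neg_mul_cosh_mul hx hb)
  rw [integral_sub i1 (i2.const_mul x), integral_const_mul] at h
  simp only [Real.cosh_zero, mul_one] at h
  linarith

lemma mul_macdonald (ν : ℝ) {x : ℝ} (hx : 0 < x) :
    ν * macdonald ν x = x * ((macdonald (ν + 1) x - macdonald (ν - 1) x) / 2) := by
  have hd (t : ℝ) : HasDerivAt (fun t => Real.sinh (ν * t)) (ν * Real.cosh (ν * t)) t := by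
    exact (((hasDerivAt_id t).const_mul ν).sinh).congr_deriv (by simp; ring)
  have hs (t : ℝ) (ht : 0 ≤ t) : |Real.sinh (ν * t)| ≤ Real.exp (|ν| * t) := by
    rw [Real.abs_sinh, abs_mul, abs_of_nonneg ht]
    exact (Real.sinh_lt_cosh _).le.trans (by simpa using Real.cosh_mul_le_exp |ν| ht)
  have h := integral_exp_neg_mul_cosh_mul_deriv hx hd (by fun_prop) (C := 1 + |ν|) (c := |ν|)
    (fun t ht => (hs t ht).trans (le_mul_of_one_le_left (Real.exp_pos _).le (by simp)))
    (fun t ht => by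
      rw [abs_mul, abs_of_pos (Real.cosh_pos _)]
      exact mul_le_mul (by simp) (Real.cosh_mul_le_exp ν ht) (Real.cosh_pos _).le (by positivity))
  simp only [mul_zero, Real.sinh_zero, zero_add, Real.sinh_mul_sinh_mul] at h
  have h1 : ∫ t in Ioi (0:ℝ), Real.exp (-x * Real.cosh t) * (ν * Real.cosh (ν * t)) =
      ν * macdonald ν x := by
    rw [macdonald, ← integral_const_mul]; congr 1; ext t; ring
  rw [← h1, ← h]
  congr 1
  simp only [macdonald]
  rw [← integral_sub (integrableOn_macdonald _ hx) (integrableOn_macdonald _ hx),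
    ← integral_div]
  congr 1; ext t; ring

lemma macdonald_neg (ν x : ℝ) : macdonald (-ν) x = macdonald ν x := by
  simp [macdonald]

lemma macdonald_mono {μ ν : ℝ} (h : |μ| ≤ |ν|) {x : ℝ} (hx : 0 < x) :
    macdonald μ x ≤ macdonald ν x := by
  refine setIntegral_mono (integrableOn_macdonald _ hx) (integrableOn_macdonald _ hx) fun t => ?_
  have : Real.cosh (μ * t) ≤ Real.cosh (ν * t) := by
    rw [Real.cosh_le_cosh, abs_mul, abs_mul]; gcongr
  gcongr

lemma le_macdonald (ν : ℝ) {x T : ℝ} (hx : 0 < x) (hT : 0 ≤ T) :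
    T * Real.exp (-x * Real.cosh T) ≤ macdonald ν x := by
  have h : ∫ t in Ioc 0 T, Real.exp (-x * Real.cosh T) ≤
      ∫ t in Ioc 0 T, Real.exp (-x * Real.cosh t) * Real.cosh (ν * t) := by
    refine setIntegral_mono_on (by simp) ((integrableOn_macdonald ν hx).mono_set
      Ioc_subset_Ioi_self) measurableSet_Ioc fun t ht => ?_
    have h1 : Real.cosh t ≤ Real.cosh T := by
      rw [Real.cosh_le_cosh, abs_of_pos ht.1, abs_of_nonneg hT]; exact ht.2
    calc _ ≤ Real.exp (-x * Real.cosh t) := Real.exp_le_exp.2 (by nlinarith)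
      _ ≤ _ := le_mul_of_one_le_right (Real.exp_pos _).le (Real.one_le_cosh _)
  have h2 : ∫ t in Ioc 0 T, Real.exp (-x * Real.cosh T) = T * Real.exp (-x * Real.cosh T) := by
    simp [hT]
  rw [h2] at h
  refine h.trans (setIntegral_mono_set (integrableOn_macdonald ν hx)
    (ae_of_all _ fun t => ?_) Ioc_subset_Ioi_self.eventuallyLE)
  have := Real.cosh_pos (ν * t)
  simp only [Pi.zero_apply]; positivity

lemma macdonald_pos (ν : ℝ) {x : ℝ} (hx : 0 < x) : 0 < macdonald ν x :=
  lt_of_lt_of_le (by positivity) (le_macdonald ν hx zero_le_one)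

end Macdonald

lemma abs_macdonald_asymptotic {ν : ℝ} (hν : 0 ≤ ν) {x : ℝ} (hx : 0 < x)
    (hx2 : 2 * (1 / 4 + ν ^ 2) ≤ x) :
    |-(x * ((macdonald (ν + 1) x + macdonald (ν - 1) x) / 2)) + (x + 1 / 2) * macdonald ν x| ≤
      (1 / 4 + ν ^ 2) / x * macdonald ν x := by
  set T : ℝ → ℝ := fun t => Real.sinh (t / 2) / Real.cosh (t / 2) with hT
  have hc0 (t : ℝ) : Real.cosh (t / 2) ≠ 0 := (Real.cosh_pos _).ne'
  have hc2 (t : ℝ) : Real.cosh t = 1 + 2 * Real.sinh (t / 2) ^ 2 := by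
    have := Real.cosh_two_mul (t / 2)
    rw [mul_div_cancel₀ t two_ne_zero] at this
    rw [this, Real.cosh_sq]; ring
  have hs2 (t : ℝ) : Real.sinh t = 2 * Real.sinh (t / 2) * Real.cosh (t / 2) := by
    rw [← Real.sinh_two_mul, mul_div_cancel₀ t two_ne_zero]
  set g' : ℝ → ℝ := fun t => Real.cosh (ν * t) / (2 * Real.cosh (t / 2) ^ 2) +
    ν * (T t * Real.sinh (ν * t)) with hg'
  have hTd (t : ℝ) : HasDerivAt T (1 / (2 * Real.cosh (t / 2) ^ 2)) t := by
    have h2 := (hasDerivAt_id t).div_const 2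
    refine (h2.sinh.div h2.cosh (hc0 t)).congr_deriv ?_
    have := hc0 t
    simp only [id]
    field_simp
    rw [Real.cosh_sq]; ring
  have hg (t : ℝ) : HasDerivAt (fun t => T t * Real.cosh (ν * t)) (g' t) t :=
    ((hTd t).mul (((hasDerivAt_id t).const_mul ν).cosh)).congr_deriv (by simp [hg']; ring)
  have hTc : Continuous T := by
    rw [hT]; exact Continuous.div (by fun_prop) (by fun_prop) hc0
  have hg'c : Continuous g' := by
    refine Continuous.add (Continuous.div (by fun_prop) (by fun_prop) fun t => ?_) (by fun_prop)
    have := hc0 t; positivity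
  have hT0 {t : ℝ} (ht : 0 ≤ t) : 0 ≤ T t :=
    div_nonneg (Real.sinh_nonneg_iff.2 (by positivity)) (Real.cosh_pos _).le
  have hT1 {t : ℝ} (ht : 0 ≤ t) : T t ≤ 1 :=
    (div_le_one (Real.cosh_pos _)).2 (Real.sinh_lt_cosh _).le
  have hTs {t : ℝ} (ht : 0 ≤ t) : T t ≤ Real.sinh (t / 2) :=
    div_le_self (Real.sinh_nonneg_iff.2 (by positivity)) (Real.one_le_cosh _)
  have hsn {t : ℝ} (ht : 0 ≤ t) : 0 ≤ Real.sinh (ν * t) := Real.sinh_nonneg_iff.2 (by positivity)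
  have hch (t : ℝ) : 1 / (2 * Real.cosh (t / 2) ^ 2) = (1 - T t ^ 2) / 2 := by
    have := hc0 t
    simp only [hT]; field_simp
    rw [Real.cosh_sq]; ring
  have hg'eq (t : ℝ) : g' t = (1 - T t ^ 2) / 2 * Real.cosh (ν * t) +
      ν * (T t * Real.sinh (ν * t)) := by
    rw [← hch]; simp only [hg']; ring
  have hb' (t : ℝ) (ht : 0 ≤ t) : |g' t| ≤ (1 + ν) * Real.exp (|ν| * t) := by
    have h1 := Real.cosh_pos (ν * t)
    have h2 := hT0 ht
    have h3 := hT1 ht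
    have h4 := hsn ht
    have h5 := Real.cosh_mul_le_exp ν ht
    have h6 := (Real.sinh_lt_cosh (ν * t)).le
    have h7 : T t * Real.sinh (ν * t) ≤ 1 * Real.exp (|ν| * t) :=
      mul_le_mul h3 (h6.trans h5) h4 zero_le_one
    have h8 : (1 - T t ^ 2) / 2 * Real.cosh (ν * t) ≤ 1 * Real.exp (|ν| * t) :=
      mul_le_mul (by nlinarith) h5 h1.le zero_le_one
    have h9 : 0 ≤ (1 - T t ^ 2) / 2 * Real.cosh (ν * t) :=
      mul_nonneg (by nlinarith) h1.le
    rw [hg'eq, abs_of_nonneg (add_nonneg h9 (mul_nonneg hν (mul_nonneg h2 h4)))]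
    nlinarith
  have key := integral_exp_neg_mul_cosh_mul_deriv hx hg hg'c (C := 1 + ν) (c := |ν|)
    (fun t ht => by
      have := Real.cosh_pos (ν * t)
      rw [abs_of_nonneg (mul_nonneg (hT0 ht) this.le)]
      calc _ ≤ 1 * Real.exp (|ν| * t) :=
            mul_le_mul (hT1 ht) (Real.cosh_mul_le_exp ν ht) this.le zero_le_one
        _ ≤ _ := by gcongr; linarith)
    hb'
  set D := ∫ t in Ioi (0:ℝ), Real.exp (-x * Real.cosh t) *
    ((Real.cosh t - 1) * Real.cosh (ν * t)) with hD
  have iK := integrableOn_macdonald ν hx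
  have iC : IntegrableOn (fun t => Real.exp (-x * Real.cosh t) *
      (Real.cosh t * Real.cosh (ν * t))) (Ioi 0) := by
    refine (((integrableOn_macdonald (ν + 1) hx).add
      (integrableOn_macdonald (ν - 1) hx)).div_const 2).congr (ae_of_all _ fun t => ?_)
    simp only [Pi.add_apply]
    rw [Real.cosh_mul_cosh_mul]; ring
  have iD : IntegrableOn (fun t => Real.exp (-x * Real.cosh t) *
      ((Real.cosh t - 1) * Real.cosh (ν * t))) (Ioi 0) :=
    (iC.sub iK).congr (ae_of_all _ fun t => by simp only [Pi.sub_apply]; ring)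
  have hDK : D = (macdonald (ν + 1) x + macdonald (ν - 1) x) / 2 - macdonald ν x := by
    rw [← integral_cosh_mul_macdonald ν hx, macdonald, ← integral_sub iC iK, hD]
    congr 1; ext t; ring
  have hxD : x * D = ∫ t in Ioi (0:ℝ), Real.exp (-x * Real.cosh t) * g' t := by
    simp only [hT, zero_div, Real.sinh_zero, zero_mul, mul_zero, zero_add] at key
    rw [← key, hD]
    congr 2; ext t
    rw [hc2 t, hs2 t]
    have := hc0 t
    field_simp; ring
  have ig' : IntegrableOn (fun t => Real.exp (-x * Real.cosh t) * g' t) (Ioi 0) :=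
    integrableOn_exp_neg_mul_cosh_mul hx hg'c hb'
  have hDpos : 0 ≤ D := setIntegral_nonneg measurableSet_Ioi fun t _ => by
    have := Real.one_le_cosh t
    have := Real.cosh_pos (ν * t)
    exact mul_nonneg (Real.exp_pos _).le (mul_nonneg (by linarith) this.le)
  have hdiff : |macdonald ν x / 2 - x * D| ≤ (1 / 4 + ν ^ 2) * D := by
    rw [hxD, macdonald, ← integral_div, ← integral_sub (iK.div_const 2) ig', hD,
      ← integral_const_mul, ← Real.norm_eq_abs]
    refine norm_integral_le_of_norm_le (iD.const_mul _)
      ((ae_restrict_iff' measurableSet_Ioi).2 (ae_of_all _ fun t (ht : 0 < t) => ?_))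
    have ht := ht.le
    have e : Real.exp (-x * Real.cosh t) * Real.cosh (ν * t) / 2 -
        Real.exp (-x * Real.cosh t) * g' t = Real.exp (-x * Real.cosh t) *
          (T t ^ 2 / 2 * Real.cosh (ν * t) - ν * (T t * Real.sinh (ν * t))) := by
      rw [hg'eq]; ring
    rw [e, Real.norm_eq_abs, abs_mul, Real.abs_exp, mul_left_comm (1 / 4 + ν ^ 2)]
    refine mul_le_mul_of_nonneg_left ?_ (Real.exp_pos _).le
    have h1 := Real.cosh_pos (ν * t)
    have h2 := hT0 ht
    have h3 := hTs ht
    have h4 := hsn ht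
    have h5 := Real.sinh_le_mul_cosh (mul_nonneg hν ht)
    have h6 : t / 2 ≤ Real.sinh (t / 2) := Real.self_le_sinh_iff.2 (by positivity)
    have h7 : T t ^ 2 ≤ Real.sinh (t / 2) ^ 2 := by gcongr
    have h8 : Real.sinh (ν * t) ≤ 2 * ν * Real.sinh (t / 2) * Real.cosh (ν * t) := by
      refine h5.trans (mul_le_mul_of_nonneg_right ?_ h1.le)
      nlinarith
    have h9 : T t * Real.sinh (ν * t) ≤
        Real.sinh (t / 2) * (2 * ν * Real.sinh (t / 2) * Real.cosh (ν * t)) :=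
      mul_le_mul h3 h8 h4 (h2.trans h3)
    rw [hc2 t]
    have h10 := mul_le_mul_of_nonneg_right h7 h1.le
    have h11 := mul_le_mul_of_nonneg_left h9 hν
    have h12 : 0 ≤ ν * (T t * Real.sinh (ν * t)) := mul_nonneg hν (mul_nonneg h2 h4)
    have h13 : 0 ≤ T t ^ 2 * Real.cosh (ν * t) := by positivity
    have h14 : 0 ≤ Real.sinh (t / 2) ^ 2 * Real.cosh (ν * t) := by positivity
    have h15 : 0 ≤ ν ^ 2 * (Real.sinh (t / 2) ^ 2 * Real.cosh (ν * t)) := by positivity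
    rw [abs_le]
    constructor <;> nlinarith
  have hle : D ≤ macdonald ν x / x := by
    rw [le_div_iff₀ hx]
    have := (abs_le.1 hdiff).1
    nlinarith
  have e : -(x * ((macdonald (ν + 1) x + macdonald (ν - 1) x) / 2)) +
      (x + 1 / 2) * macdonald ν x = macdonald ν x / 2 - x * D := by
    rw [hDK]; ring
  rw [e]
  refine hdiff.trans ?_
  calc _ ≤ (1 / 4 + ν ^ 2) * (macdonald ν x / x) := by gcongr
    _ = _ := by ring

lemma mul_macdonald_one_le {x : ℝ} (hx : 0 < x) : x * macdonald 1 x ≤ 1 + x * macdonald 0 x := by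
  have h := integral_exp_neg_mul_cosh_mul_deriv hx (g := fun _ => 1) (g' := fun _ => 0) (C := 1)
    (c := 0) (fun t => hasDerivAt_const t 1) (by fun_prop) (by simp) (by simp)
  simp only [mul_one, mul_zero, integral_zero, add_zero] at h
  have i0 := integrableOn_macdonald 0 hx
  have i1 := integrableOn_macdonald 1 hx
  have i2 : IntegrableOn (fun t => Real.exp (-x * Real.cosh t) * Real.sinh t) (Ioi 0) :=
    integrableOn_exp_neg_mul_cosh_mul hx (by fun_prop) (C := 1) (c := |1|) fun t ht => by
      rw [Real.abs_sinh, abs_of_nonneg ht, one_mul]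
      simpa using (Real.sinh_lt_cosh _).le.trans (Real.cosh_mul_le_exp 1 ht)
  have h1 : macdonald 1 x ≤ (∫ t in Ioi (0:ℝ), Real.exp (-x * Real.cosh t) * Real.sinh t) +
      macdonald 0 x := by
    rw [macdonald, macdonald, ← integral_add i2 i0]
    refine setIntegral_mono_on i1 (i2.add i0) measurableSet_Ioi fun t ht => ?_
    have e : Real.cosh t = Real.sinh t + Real.exp (-t) := by
      rw [← Real.cosh_sub_sinh]; ring
    have : Real.exp (-t) ≤ 1 := Real.exp_le_one_iff.2 (by simpa using le_of_lt ht)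
    rw [one_mul, zero_mul, Real.cosh_zero, ← mul_add]
    gcongr
    linarith
  have h2 : Real.exp (-x) ≤ 1 := Real.exp_le_one_iff.2 (by linarith)
  nlinarith [mul_le_mul_of_nonneg_left h1 hx.le]

lemma eventually_mul_macdonald_sub_one_le (n : ℕ) {ε : ℝ} (hε : 0 < ε) :
    ∀ᶠ x in 𝓝[>] (0:ℝ), x * macdonald (n - 1) x ≤ ε * macdonald n x := by
  rcases n.eq_zero_or_pos with rfl | hn
  · set T := 4 / ε * Real.exp 1
    have h1 : ∀ᶠ x in 𝓝[>] (0:ℝ), x * Real.cosh T < 1 := by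
      have : Tendsto (fun x : ℝ => x * Real.cosh T) (𝓝[>] 0) (𝓝 (0 * Real.cosh T)) :=
        (tendsto_id.mul_const _).mono_left nhdsWithin_le_nhds
      rw [zero_mul] at this
      exact this.eventually_lt_const one_pos
    have h2 : ∀ᶠ x in 𝓝[>] (0:ℝ), x < ε / 2 :=
      nhdsWithin_le_nhds (eventually_lt_nhds (half_pos hε))
    filter_upwards [h1, h2, self_mem_nhdsWithin] with x h1 h2 (hx : 0 < x)
    have h3 := mul_macdonald_one_le hx
    have h4 := le_macdonald 0 hx (T := T) (by positivity)
    have h5 : Real.exp (-1) ≤ Real.exp (-x * Real.cosh T) := Real.exp_le_exp.2 (by linarith)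
    have h6 : 4 / ε ≤ macdonald 0 x := by
      refine le_trans ?_ h4
      calc 4 / ε = T * Real.exp (-1) := by
            simp only [T]; rw [mul_assoc, ← Real.exp_add]; simp
        _ ≤ _ := by gcongr
    have h7 : 4 ≤ ε * macdonald 0 x := by rwa [div_le_iff₀' hε] at h6
    have e : macdonald ((0:ℕ) - 1) x = macdonald 1 x := by
      rw [← macdonald_neg]; norm_num
    rw [e, Nat.cast_zero]
    nlinarith [macdonald_pos 0 hx]
  · have h2 : ∀ᶠ x in 𝓝[>] (0:ℝ), x < ε :=
      nhdsWithin_le_nhds (eventually_lt_nhds hε)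
    filter_upwards [h2, self_mem_nhdsWithin] with x h2 (hx : 0 < x)
    have hn' : (1:ℝ) ≤ n := by exact_mod_cast hn
    have := macdonald_mono (μ := n - 1) (ν := n) (by
      rw [abs_of_nonneg (by linarith), abs_of_nonneg (by linarith)]; linarith) hx
    exact mul_le_mul h2.le this (macdonald_pos _ hx).le hε.le

lemma differentiableAt_integral_of_loc_bound {μ : Measure ℝ} {f : ℂ → ℝ → ℂ}
    (hf : Continuous (Function.uncurry f)) (hd : ∀ t, Differentiable ℂ (f · t)) {w₀ : ℂ}
    {bound : ℝ → ℝ} (hb : ∀ᵐ t ∂μ, ∀ w ∈ Metric.ball w₀ 2, ‖f w t‖ ≤ bound t)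
    (hi : Integrable bound μ) : DifferentiableAt ℂ (fun w => ∫ t, f w t ∂μ) w₀ := by
  have hm (w : ℂ) : AEStronglyMeasurable (f w) μ :=
    (hf.comp (Continuous.prodMk_right w)).aestronglyMeasurable
  have hf' : Continuous (Function.uncurry fun t w => f w t) := hf.comp continuous_swap
  refine (hasDerivAt_integral_of_dominated_loc_of_deriv_le (F := f)
    (F' := fun w t => deriv (f · t) w) (bound := bound)
    (Metric.ball_mem_nhds w₀ one_pos) (Eventually.of_forall hm)
    (hi.mono' (hm w₀) ?_) ?_ ?_ hi ?_).2.differentiableAt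
  · filter_upwards [hb] with t ht using ht w₀ (Metric.mem_ball_self two_pos)
  · exact ((measurable_deriv_with_param hf').comp (by fun_prop :
      Measurable fun t : ℝ => (t, w₀))).aestronglyMeasurable
  · filter_upwards [hb] with t ht w hw
    have := Complex.norm_deriv_le_of_forall_mem_sphere_norm_le (c := w) (R := 1) (C := bound t)
      one_pos (hd t).diffContOnCl fun z hz => ht z ?_
    · simpa using this
    · rw [Metric.mem_ball] at hw ⊢
      rw [mem_sphere_iff_norm, ← dist_eq_norm] at hz
      linarith [dist_triangle z w w₀]
  · exact ae_of_all _ fun t w _ => (hd t w).hasDerivAt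

/-- The entire function whose restriction to the real line is `x ↦ K_ν(eˣ)`. -/
noncomputable def expMacdonald (ν : ℝ) (w : ℂ) : ℂ :=
  (∫ s in Ioi (0:ℝ), Complex.exp (-(Complex.exp s + Complex.exp (2 * w - s)) / 2) *
      Complex.cosh (ν * (s - w))) -
    ∫ u in Ioc (0:ℝ) 1, w * (Complex.exp (-Complex.exp w * Complex.cosh (u * w)) *
      Complex.cosh (ν * (u * w)))

lemma Complex.norm_cosh_le (z : ℂ) : ‖Complex.cosh z‖ ≤ Real.exp ‖z‖ := by
  have h1 : ‖Complex.exp z‖ ≤ Real.exp ‖z‖ := Complex.norm_exp_le_exp_norm z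
  have h2 : ‖Complex.exp (-z)‖ ≤ Real.exp ‖z‖ := by
    simpa using Complex.norm_exp_le_exp_norm (-z)
  rw [Complex.cosh, norm_div, Complex.norm_ofNat, div_le_iff₀ two_pos]
  linarith [norm_add_le (Complex.exp z) (Complex.exp (-z))]

lemma differentiable_expMacdonald (ν : ℝ) : Differentiable ℂ (expMacdonald ν) := by
  intro w₀
  refine DifferentiableAt.sub ?_ ?_
  · set R := ‖w₀‖ + 2
    refine differentiableAt_integral_of_loc_bound (f := fun w s => Complex.exp
      (-(Complex.exp s + Complex.exp (2 * w - s)) / 2) * Complex.cosh (ν * (s - w)))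
      (bound := fun s => Real.exp (Real.exp (2 * R)) * Real.exp (|ν| * R) *
        (Real.exp (-(1 / 2) * Real.cosh s) * Real.exp (|ν| * s)))
      (by fun_prop) (fun t => by fun_prop) ?_ ?_
    · refine (ae_restrict_iff' measurableSet_Ioi).2 (ae_of_all _ fun s (hs : 0 < s) w hw => ?_)
      have hw : ‖w‖ ≤ R := by
        rw [mem_ball_iff_norm] at hw
        have := norm_le_norm_add_norm_sub' w w₀
        simp only [R]; linarith
      have hre : |w.re| ≤ R := (Complex.abs_re_le_norm w).trans hw
      have h1 : ‖Complex.cosh (ν * (s - w))‖ ≤ Real.exp (|ν| * R) * Real.exp (|ν| * s) := by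
        refine (Complex.norm_cosh_le _).trans ?_
        rw [← Real.exp_add, Real.exp_le_exp, norm_mul, Complex.norm_real, Real.norm_eq_abs,
          ← mul_add]
        gcongr
        have := norm_sub_le (s:ℂ) w
        rw [Complex.norm_real, Real.norm_of_nonneg hs.le] at this
        linarith
      have h2 : ‖Complex.exp (-(Complex.exp s + Complex.exp (2 * w - s)) / 2)‖ ≤
          Real.exp (Real.exp (2 * R)) * Real.exp (-(1 / 2) * Real.cosh s) := by
        rw [Complex.norm_exp, ← Real.exp_add, Real.exp_le_exp]
        have h3 : -(Complex.exp (2 * w - s)).re ≤ Real.exp (2 * R) := by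
          refine (neg_le_abs _).trans ((Complex.abs_re_le_norm _).trans ?_)
          rw [Complex.norm_exp, Real.exp_le_exp]
          simp
          linarith [le_abs_self w.re]
        have h4 : Real.cosh s ≤ Real.exp s := by
          rw [Real.cosh_eq]
          have := Real.exp_le_exp.2 (show -s ≤ s by linarith)
          linarith
        have e : (-(Complex.exp s + Complex.exp (2 * w - s)) / 2).re =
            -(Real.exp s + (Complex.exp (2 * w - s)).re) / 2 := by
          simp [Complex.exp_ofReal_re]
        rw [e]
        linarith [Real.exp_pos (2 * R)]
      rw [norm_mul]
      calc _ ≤ (Real.exp (Real.exp (2 * R)) * Real.exp (-(1 / 2) * Real.cosh s)) *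
            (Real.exp (|ν| * R) * Real.exp (|ν| * s)) :=
            mul_le_mul h2 h1 (norm_nonneg _) (by positivity)
        _ = _ := by ring
    · exact (integrableOn_exp_neg_mul_cosh_mul one_half_pos (by fun_prop) (C := 1) (c := |ν|)
        fun t _ => by rw [Real.abs_exp, one_mul]).const_mul _
  · set f : ℂ → ℝ → ℂ := fun w u => w * (Complex.exp (-Complex.exp w * Complex.cosh (u * w)) *
      Complex.cosh (ν * (u * w)))
    have hf : Continuous (Function.uncurry f) := by fun_prop
    obtain ⟨M, hM⟩ := ((isCompact_closedBall w₀ 2).prod (isCompact_Icc (a := (0:ℝ)) (b := 1))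
      ).exists_bound_of_continuousOn hf.continuousOn
    refine differentiableAt_integral_of_loc_bound (f := f) (bound := fun _ => M) hf
      (fun t => by fun_prop) ?_ (by simp)
    refine (ae_restrict_iff' measurableSet_Ioc).2 (ae_of_all _ fun u hu w hw => ?_)
    exact hM (w, u) ⟨Metric.ball_subset_closedBall hw, Ioc_subset_Icc_self hu⟩

lemma expMacdonald_ofReal (ν x : ℝ) : expMacdonald ν x = macdonald ν (Real.exp x) := by
  set h : ℝ → ℝ := fun t => Real.exp (-Real.exp x * Real.cosh t) * Real.cosh (ν * t) with hh
  have hc : Continuous h := by fun_prop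
  have e1 : (∫ s in Ioi (0:ℝ), Complex.exp (-(Complex.exp s + Complex.exp (2 * x - s)) / 2) *
      Complex.cosh (ν * (s - x))) = (∫ s in Ioi (0:ℝ), h (s - x) : ℝ) := by
    refine Eq.trans ?_ integral_complex_ofReal
    congr 1; ext s
    have : Real.exp x * Real.cosh (s - x) = (Real.exp s + Real.exp (2 * x - s)) / 2 := by
      rw [Real.cosh_eq, mul_div_assoc', mul_add, ← Real.exp_add, ← Real.exp_add]
      ring_nf
    simp only [hh, neg_mul, this]
    simp
    ring_nf
    simp
  have e2 : (∫ u in Ioc (0:ℝ) 1, (x:ℂ) * (Complex.exp (-Complex.exp x * Complex.cosh (u * x)) *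
      Complex.cosh (ν * (u * x)))) = (∫ t in (0:ℝ)..x, h t : ℝ) := by
    have := intervalIntegral.smul_integral_comp_mul_right (a := 0) (b := 1) h x
    rw [zero_mul, one_mul] at this
    rw [← this, ← intervalIntegral.integral_smul, intervalIntegral.integral_of_le zero_le_one]
    refine Eq.trans ?_ integral_complex_ofReal
    congr 1; ext s
    simp [hh]
  have e3 : ∫ s in Ioi (0:ℝ), h (s - x) = ∫ t in Ioi (-x), h t := by
    have := (measurePreserving_sub_right volume x).setIntegral_preimage_emb
      (measurableEmbedding_subRight x) h (Ioi (-x))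
    simpa using this
  rw [expMacdonald, e1, e2, e3, ← Complex.ofReal_sub]
  congr 1
  have i0 : IntegrableOn h (Ioi 0) := integrableOn_macdonald ν (Real.exp_pos x)
  have e4 : ∫ t in (0:ℝ)..x, h t = ∫ t in (-x)..0, h t := by
    have := intervalIntegral.integral_comp_neg (a := 0) (b := x) h
    rw [neg_zero] at this
    rw [← this]
    simp [hh]
  have e5 := intervalIntegral.integral_interval_add_Ioi' (hc.intervalIntegrable (-x) 0) i0
  rw [e4, ← e5]; simp [macdonald, hh]

lemma Complex.cosh_nat_mul_add_pi_mul_I (n : ℕ) (t : ℂ) :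
    Complex.cosh (n * (t + Real.pi * Complex.I)) = (-1) ^ n * Complex.cosh (n * t) := by
  have h1 : Complex.cosh (n * (Real.pi * Complex.I)) = (-1) ^ n := by
    rw [← mul_assoc, Complex.cosh_mul_I]
    exact_mod_cast congrArg Complex.ofReal (Real.cos_nat_mul_pi n)
  have h2 : Complex.sinh (n * (Real.pi * Complex.I)) = 0 := by
    rw [← mul_assoc, Complex.sinh_mul_I, Complex.sin_nat_mul_pi, zero_mul]
  rw [mul_add, Complex.cosh_add, h1, h2]; ring

lemma Complex.cosh_nat_mul_sub_pi_mul_I (n : ℕ) (t : ℂ) :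
    Complex.cosh (n * (t - Real.pi * Complex.I)) = (-1) ^ n * Complex.cosh (n * t) := by
  have h := Complex.cosh_nat_mul_add_pi_mul_I n (t - Real.pi * Complex.I)
  rw [sub_add_cancel] at h
  rw [h, ← mul_assoc, ← mul_pow]; simp

lemma integral_Ioc_mul_comp_mul {g G : ℂ → ℂ} (hg : Continuous g)
    (hG : ∀ t, HasDerivAt G (g t) t) (w : ℂ) :
    ∫ u in Ioc (0:ℝ) 1, w * g (u * w) = G w - G 0 := by
  rw [← intervalIntegral.integral_of_le zero_le_one]
  have hd (u : ℝ) : HasDerivAt (fun u : ℝ => G (u * w)) (w * g (u * w)) u := by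
    have h1 : HasDerivAt (fun u : ℝ => (u:ℂ) * w) w u := by
      simpa using (Complex.ofRealCLM.hasDerivAt (x := u)).mul_const w
    exact ((hG (u * w)).comp u h1).congr_deriv (by ring)
  have := intervalIntegral.integral_eq_sub_of_hasDerivAt (a := 0) (b := 1) (fun u _ => hd u)
    (Continuous.intervalIntegrable (by fun_prop) _ _)
  simpa using this

theorem expMacdonald_add_pi_mul_I_add_sub (n : ℕ) (w : ℂ) :
    expMacdonald n (w + Real.pi * Complex.I) + expMacdonald n (w - Real.pi * Complex.I) =
      2 * (-1) ^ n * expMacdonald n w := by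
  set c := Complex.exp w
  set h : ℂ → ℂ := fun t => Complex.exp (c * Complex.cosh t) * Complex.cosh (n * t) with hh
  set k : ℂ → ℂ := fun t => Complex.exp (-c * Complex.cosh t) * Complex.cosh (n * t) with hk
  have hhd : Differentiable ℂ h := by fun_prop
  have hkd : Differentiable ℂ k := by fun_prop
  obtain ⟨P, hP⟩ := hhd.isExactOn_univ
  obtain ⟨Q, hQ⟩ := hkd.isExactOn_univ
  replace hP := fun t => hP t (mem_univ t)
  replace hQ := fun t => hQ t (mem_univ t)
  have hexp1 : Complex.exp (w + Real.pi * Complex.I) = -c := by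
    rw [Complex.exp_add, Complex.exp_pi_mul_I]; ring
  have hexp2 : Complex.exp (w - Real.pi * Complex.I) = -c := by
    rw [Complex.exp_sub, Complex.exp_pi_mul_I]; ring
  have b0 := integral_Ioc_mul_comp_mul hkd.continuous hQ w
  have b1 := integral_Ioc_mul_comp_mul hhd.continuous hP (w + Real.pi * Complex.I)
  have b2 := integral_Ioc_mul_comp_mul hhd.continuous hP (w - Real.pi * Complex.I)
  have hP' (a t : ℂ) : HasDerivAt (fun t => P (t + a)) (h (t + a)) t := (hP _).comp_add_const t a
  have hR : P (w + Real.pi * Complex.I) + P (w - Real.pi * Complex.I) - 2 * (-1) ^ n * Q w =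
      P (Real.pi * Complex.I) + P (-(Real.pi * Complex.I)) - 2 * (-1) ^ n * Q 0 := by
    have hd (t : ℂ) : HasDerivAt (fun t => P (t + Real.pi * Complex.I) +
        P (t + -(Real.pi * Complex.I)) - 2 * (-1) ^ n * Q t) 0 t := by
      refine (((hP' _ t).add (hP' _ t)).sub ((hQ t).const_mul _)).congr_deriv ?_
      simp only [hh, hk, ← sub_eq_add_neg, Complex.cosh_add_pi_mul_I, Complex.cosh_sub_pi_mul_I,
        Complex.cosh_nat_mul_add_pi_mul_I, Complex.cosh_nat_mul_sub_pi_mul_I]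
      rw [mul_neg, neg_mul]; ring
    have := is_const_of_deriv_eq_zero (fun t => (hd t).differentiableAt)
      (fun t => (hd t).deriv) w 0
    simpa [sub_eq_add_neg] using this
  have hS : P (Real.pi * Complex.I) + P (-(Real.pi * Complex.I)) = 2 * P 0 := by
    have hd (t : ℂ) : HasDerivAt (fun t => P t + P (-t)) 0 t := by
      refine ((hP t).add ((hP (-t)).comp t (hasDerivAt_neg t))).congr_deriv ?_
      simp [hh]
    have := is_const_of_deriv_eq_zero (fun t => (hd t).differentiableAt)
      (fun t => (hd t).deriv) (Real.pi * Complex.I) 0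
    simpa [two_mul] using this
  simp only [expMacdonald, hexp1, hexp2, neg_neg]
  simp only [hh, hk] at b0 b1 b2
  simp only [Complex.ofReal_natCast]
  rw [b0, b1, b2]
  have a1 (s : ℝ) : Complex.exp (2 * (w + Real.pi * Complex.I) - s) = Complex.exp (2 * w - s) := by
    rw [← Complex.exp_periodic (2 * w - s)]; ring_nf
  have a2 (s : ℝ) : Complex.exp (2 * (w - Real.pi * Complex.I) - s) = Complex.exp (2 * w - s) := by
    rw [← Complex.exp_periodic (2 * (w - Real.pi * Complex.I) - s)]; ring_nf
  have a3 (s : ℝ) : Complex.cosh (n * (s - (w + Real.pi * Complex.I))) =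
      (-1) ^ n * Complex.cosh (n * (s - w)) := by
    rw [← Complex.cosh_nat_mul_sub_pi_mul_I]; ring_nf
  have a4 (s : ℝ) : Complex.cosh (n * (s - (w - Real.pi * Complex.I))) =
      (-1) ^ n * Complex.cosh (n * (s - w)) := by
    rw [← Complex.cosh_nat_mul_add_pi_mul_I]; ring_nf
  simp only [a1, a2, a3, a4, mul_left_comm _ ((-1 : ℂ) ^ n), integral_const_mul]
  linear_combination -hR - hS

lemma Differentiable.eq_of_eq_ofReal {f g : ℂ → ℂ} (hf : Differentiable ℂ f)
    (hg : Differentiable ℂ g) (h : ∀ x : ℝ, f x = g x) : f = g := by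
  refine AnalyticOnNhd.eq_of_frequently_eq (z₀ := 0) (hf.differentiableOn.analyticOnNhd isOpen_univ)
    (hg.differentiableOn.analyticOnNhd isOpen_univ) ?_
  have ht : Tendsto (fun x : ℝ => (x:ℂ)) (𝓝[≠] 0) (𝓝[≠] 0) := by
    refine tendsto_nhdsWithin_of_tendsto_nhds_of_eventually_within _ ?_ ?_
    · exact (Complex.continuous_ofReal.tendsto' 0 0 (by simp)).mono_left nhdsWithin_le_nhds
    · filter_upwards [self_mem_nhdsWithin] with x hx
      simpa using hx
  exact ht.frequently (Eventually.of_forall h).frequently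

lemma deriv_expMacdonald_ofReal (ν x : ℝ) : deriv (expMacdonald ν) x =
    -Real.exp x * ((macdonald (ν + 1) (Real.exp x) + macdonald (ν - 1) (Real.exp x)) / 2) := by
  have h1 : HasDerivAt (fun x : ℝ => expMacdonald ν x) (deriv (expMacdonald ν) x) x :=
    (differentiable_expMacdonald ν x).hasDerivAt.comp_ofReal
  have h2 := ((hasDerivAt_macdonald ν (Real.exp_pos x)).comp x (Real.hasDerivAt_exp x)).ofReal_comp
  have h3 : HasDerivAt (fun x : ℝ => expMacdonald ν x) _ x :=
    h2.congr_of_eventuallyEq (Eventually.of_forall fun y => expMacdonald_ofReal ν y)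
  rw [h1.unique h3]
  push_cast; ring

lemma deriv_expMacdonald_eq_sub_one (ν : ℝ) (w : ℂ) : deriv (expMacdonald ν) w =
    -ν * expMacdonald ν w - Complex.exp w * expMacdonald (ν - 1) w := by
  have hd := differentiable_expMacdonald
  refine congrFun (Differentiable.eq_of_eq_ofReal (hd ν).deriv
    (((hd ν).const_mul (-ν : ℂ)).sub (Complex.differentiable_exp.mul (hd (ν - 1)))) fun x => ?_) w
  have h := congrArg (Complex.ofReal) (mul_macdonald ν (Real.exp_pos x))
  push_cast at h
  simp only [Pi.sub_apply, Pi.mul_apply]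
  rw [deriv_expMacdonald_ofReal, expMacdonald_ofReal, expMacdonald_ofReal]
  push_cast
  linear_combination h

lemma deriv_expMacdonald_eq_add_one (ν : ℝ) (w : ℂ) : deriv (expMacdonald ν) w =
    ν * expMacdonald ν w - Complex.exp w * expMacdonald (ν + 1) w := by
  have hd := differentiable_expMacdonald
  refine congrFun (Differentiable.eq_of_eq_ofReal (hd ν).deriv
    (((hd ν).const_mul (ν : ℂ)).sub (Complex.differentiable_exp.mul (hd (ν + 1)))) fun x => ?_) w
  have h := congrArg (Complex.ofReal) (mul_macdonald ν (Real.exp_pos x))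
  push_cast at h
  simp only [Pi.sub_apply, Pi.mul_apply]
  rw [deriv_expMacdonald_ofReal, expMacdonald_ofReal, expMacdonald_ofReal]
  push_cast
  linear_combination -h

/-- The modified Bessel equation in the variable `w = log z`. -/
theorem deriv_deriv_expMacdonald (ν : ℝ) (w : ℂ) : deriv (deriv (expMacdonald ν)) w =
    (Complex.exp (2 * w) + ν ^ 2) * expMacdonald ν w := by
  have hd := differentiable_expMacdonald
  have h : HasDerivAt (deriv (expMacdonald ν)) _ w :=
    (((hd ν w).hasDerivAt.const_mul (-ν : ℂ)).sub
      ((Complex.hasDerivAt_exp w).mul (hd (ν - 1) w).hasDerivAt)).congr_of_eventuallyEq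
      (Eventually.of_forall (deriv_expMacdonald_eq_sub_one ν))
  have h1 := deriv_expMacdonald_eq_add_one (ν - 1) w
  rw [sub_add_cancel] at h1
  have h2 := deriv_expMacdonald_eq_sub_one ν w
  have h3 : Complex.exp (2 * w) = Complex.exp w ^ 2 := by rw [← Complex.exp_nat_mul]; simp
  rw [h.deriv, h1, h2, h3]
  push_cast; ring

open ComplexConjugate in
lemma expMacdonald_conj (ν : ℝ) (w : ℂ) :
    expMacdonald ν (conj w) = conj (expMacdonald ν w) := by
  have hd := differentiable_expMacdonald ν
  have h : Differentiable ℂ (fun w => conj (expMacdonald ν (conj w))) := fun w =>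
    differentiableAt_conj_conj_iff.2 (hd (conj w))
  have := congrFun (Differentiable.eq_of_eq_ofReal h hd fun x => by
    rw [Complex.conj_ofReal, expMacdonald_ofReal, Complex.conj_ofReal]) w
  rw [← this, Complex.conj_conj]

lemma eq_expMacdonald_log {n : ℕ} {K : ℂ → ℂ} (hK : AnalyticOnNhd ℂ K Complex.slitPlane)
    (hKval : ∀ x : ℝ, 0 < x → K (x : ℂ) = (besselK n x : ℂ)) {z : ℂ} (hz : z ∈ Complex.slitPlane) :
    K z = expMacdonald n (Complex.log z) := by
  have hF : AnalyticOnNhd ℂ (fun z => expMacdonald n (Complex.log z)) Complex.slitPlane :=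
    DifferentiableOn.analyticOnNhd (fun z hz => ((differentiable_expMacdonald n _).comp z
      (Complex.differentiableAt_log hz)).differentiableWithinAt) Complex.isOpen_slitPlane
  have hc : IsPreconnected Complex.slitPlane :=
    (Complex.starConvex_one_slitPlane.isPathConnected
      Complex.one_mem_slitPlane).isConnected.isPreconnected
  refine hK.eqOn_of_preconnected_of_frequently_eq hF hc (z₀ := 1) Complex.one_mem_slitPlane ?_ hz
  have ht : Tendsto (fun x : ℝ => (x:ℂ)) (𝓝[≠] 1) (𝓝[≠] 1) := by
    refine tendsto_nhdsWithin_of_tendsto_nhds_of_eventually_within _ ?_ ?_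
    · exact (Complex.continuous_ofReal.tendsto' 1 1 (by simp)).mono_left nhdsWithin_le_nhds
    · filter_upwards [self_mem_nhdsWithin] with x hx
      simpa using hx
  refine ht.frequently (Eventually.frequently ?_)
  filter_upwards [nhdsWithin_le_nhds (eventually_gt_nhds (zero_lt_one' ℝ))] with x hx
  rw [hKval x hx, ← Complex.ofReal_log hx.le, expMacdonald_ofReal, Real.exp_log hx]
  rfl

lemma norm_le_of_hasDerivAt_mul {g g₁ E d : ℝ → ℂ} {C ε : ℝ} (hC : 0 ≤ C) (hε : 0 ≤ ε)
    (hε1 : 12 * ε ≤ 1) (hg : ∀ θ, HasDerivAt g (Complex.I * g₁ θ) θ)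
    (hEg : ∀ θ, HasDerivAt (fun θ => E θ * g₁ θ) (d θ) θ) (hEc : Continuous E) (hdc : Continuous d)
    (hd : ∀ θ, ‖d θ‖ ≤ C * ‖E θ‖ * ‖g θ‖) (hE : ∀ θ, E θ ≠ 0)
    (hE0 : ∀ θ ∈ Icc 0 Real.pi, ‖E 0‖ ≤ ‖E θ‖)
    (hint : ∀ θ ∈ Icc 0 Real.pi, C * ∫ φ in 0..θ, ‖E φ‖ ≤ ε * ‖E θ‖)
    (h0 : ‖g₁ 0‖ ≤ ε * ‖g 0‖) {θ : ℝ} (hθ : θ ∈ Icc 0 Real.pi) :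
    ‖g₁ θ‖ ≤ 3 * ε * ‖g 0‖ ∧ ‖g θ - g 0‖ ≤ 12 * ε * ‖g 0‖ := by
  have hgc : Continuous g := continuous_iff_continuousAt.2 fun θ => (hg θ).continuousAt
  obtain ⟨m, hm, hmax⟩ := isCompact_Icc.exists_isMaxOn (nonempty_Icc.2 Real.pi_pos.le)
    hgc.norm.continuousOn
  set M := ‖g m‖
  have hM (φ) (hφ : φ ∈ Icc 0 Real.pi) : ‖g φ‖ ≤ M := hmax hφ
  have key (θ) (hθ : θ ∈ Icc 0 Real.pi) : ‖g₁ θ‖ ≤ ε * (‖g 0‖ + M) := by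
    have h1 : ‖E θ * g₁ θ - E 0 * g₁ 0‖ ≤ ε * ‖E θ‖ * M := by
      rw [← intervalIntegral.integral_eq_sub_of_hasDerivAt (fun x _ => hEg x)
        (hdc.intervalIntegrable _ _)]
      calc _ ≤ ∫ φ in 0..θ, C * M * ‖E φ‖ := by
            refine intervalIntegral.norm_integral_le_of_norm_le hθ.1 (ae_of_all _ fun φ hφ => ?_)
              (Continuous.intervalIntegrable (by fun_prop) _ _)
            have := mul_le_mul_of_nonneg_left (hM φ ⟨hφ.1.le, hφ.2.trans hθ.2⟩)
              (by positivity : 0 ≤ C * ‖E φ‖)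
            linarith [hd φ]
        _ = (C * ∫ φ in 0..θ, ‖E φ‖) * M := by
            rw [intervalIntegral.integral_const_mul]; ring
        _ ≤ _ := mul_le_mul_of_nonneg_right (hint θ hθ) (norm_nonneg _)
    have h2 : ‖E θ‖ * ‖g₁ θ‖ ≤ ‖E θ * g₁ θ - E 0 * g₁ 0‖ + ‖E 0‖ * ‖g₁ 0‖ := by
      rw [← norm_mul, ← norm_mul]
      exact norm_le_norm_sub_add _ _
    have h3 : ‖E 0‖ * ‖g₁ 0‖ ≤ ‖E θ‖ * (ε * ‖g 0‖) :=
      mul_le_mul (hE0 θ hθ) h0 (norm_nonneg _) (norm_nonneg _)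
    refine le_of_mul_le_mul_left ?_ (norm_pos_iff.2 (hE θ))
    linarith
  have key2 (θ) (hθ : θ ∈ Icc 0 Real.pi) : ‖g θ - g 0‖ ≤ 4 * (ε * (‖g 0‖ + M)) := by
    have := (convex_Icc 0 Real.pi).norm_image_sub_le_of_norm_hasDerivWithin_le
      (fun x _ => (hg x).hasDerivWithinAt) (C := ε * (‖g 0‖ + M))
      (fun x hx => by simpa using key x hx) (left_mem_Icc.2 Real.pi_pos.le) hθ
    refine this.trans ?_
    rw [mul_comm]
    refine mul_le_mul_of_nonneg_right ?_ (by positivity)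
    rw [sub_zero, Real.norm_eq_abs, abs_of_nonneg hθ.1]
    exact hθ.2.trans Real.pi_le_four
  have hM2 : M ≤ 2 * ‖g 0‖ := by
    have h1 : M ≤ ‖g m - g 0‖ + ‖g 0‖ := norm_le_norm_sub_add _ _
    have h2 := key2 m hm
    nlinarith [norm_nonneg (g 0), norm_nonneg (g m)]
  have h4 : ε * (‖g 0‖ + M) ≤ ε * (3 * ‖g 0‖) := mul_le_mul_of_nonneg_left (by linarith) hε
  exact ⟨by linarith [key θ hθ], by linarith [key2 θ hθ]⟩

lemma hasDerivAt_comp_add_mul_I {G : ℂ → ℂ} (hG : Differentiable ℂ G) (x θ : ℝ) :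
    HasDerivAt (fun θ : ℝ => G (x + θ * Complex.I))
      (Complex.I * deriv G (x + θ * Complex.I)) θ := by
  have h1 : HasDerivAt (fun θ : ℝ => (x:ℂ) + θ * Complex.I) Complex.I θ := by
    simpa using ((Complex.ofRealCLM.hasDerivAt (x := θ)).mul_const Complex.I).const_add (x:ℂ)
  exact ((hG _).hasDerivAt.comp θ h1).congr_deriv (mul_comm _ _)

lemma vertical_estimate {G B c : ℂ → ℂ} {x C ε : ℝ} (hG : Differentiable ℂ G)
    (hB : Differentiable ℂ B) (hc : Continuous c)
    (hode : ∀ w, deriv (deriv G) w = deriv B w * deriv G w + c w * G w)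
    (hC : ∀ θ : ℝ, ‖c (x + θ * Complex.I)‖ ≤ C) (hε : 0 < ε) (hε1 : ε ≤ 1)
    (hB0 : ∀ θ ∈ Icc 0 Real.pi, (B (x + θ * Complex.I)).re ≤ (B x).re)
    (hint : ∀ θ ∈ Icc 0 Real.pi, C * ∫ φ in 0..θ, Real.exp ((B (x + θ * Complex.I)).re -
      (B (x + φ * Complex.I)).re) ≤ ε / 24)
    (h0 : ‖deriv G x‖ ≤ ε / 24 * ‖G x‖) (hG0 : G x ≠ 0) {θ : ℝ} (hθ : θ ∈ Icc 0 Real.pi) :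
    G (x + θ * Complex.I) ≠ 0 ∧ ‖deriv G (x + θ * Complex.I)‖ ≤ ε * ‖G (x + θ * Complex.I)‖ ∧
      ‖G (x + θ * Complex.I) - G x‖ ≤ ε * ‖G x‖ := by
  have hC0 : 0 ≤ C := (norm_nonneg _).trans (hC 0)
  have hEd : Differentiable ℂ fun w => Complex.exp (-B w) := hB.neg.cexp
  have hode' (w : ℂ) : deriv ((fun w => Complex.exp (-B w)) * deriv G) w =
      Complex.exp (-B w) * c w * G w := by
    rw [deriv_mul (hEd w) (hG.deriv w), hode, (hB w).hasDerivAt.fun_neg.cexp.deriv]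
    ring
  have hn (θ : ℝ) : ‖Complex.exp (-B (x + θ * Complex.I))‖ =
      Real.exp (-(B (x + θ * Complex.I)).re) := by simp [Complex.norm_exp]
  have hBc := hB.continuous
  have hGc := hG.continuous
  have key := norm_le_of_hasDerivAt_mul (g := fun θ : ℝ => G (x + θ * Complex.I))
    (g₁ := fun θ : ℝ => deriv G (x + θ * Complex.I))
    (E := fun θ : ℝ => Complex.exp (-B (x + θ * Complex.I)))
    (d := fun θ : ℝ => Complex.I * (Complex.exp (-B (x + θ * Complex.I)) *
      c (x + θ * Complex.I) * G (x + θ * Complex.I))) (C := C) (ε := ε / 24) hC0 (by positivity)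
    (by linarith) (hasDerivAt_comp_add_mul_I hG x)
    (fun θ => (hasDerivAt_comp_add_mul_I (hEd.mul hG.deriv) x θ).congr_deriv (by rw [hode']))
    (by fun_prop) (by fun_prop) (fun θ => ?_) (fun θ => Complex.exp_ne_zero _) (fun θ hθ => ?_)
    (fun θ hθ => ?_) (by simpa using h0) hθ
  · simp only [Complex.ofReal_zero, zero_mul, add_zero] at key
    obtain ⟨k1, k2⟩ := key
    have k3 := norm_sub_norm_le (G x) (G (x + θ * Complex.I))
    rw [norm_sub_rev] at k3
    have h5 : 0 < ‖G x‖ := norm_pos_iff.2 hG0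
    have h6 : 12 * (ε / 24) * ‖G x‖ ≤ 1 / 2 * ‖G x‖ :=
      mul_le_mul_of_nonneg_right (by linarith) h5.le
    have h7 : ‖G x‖ ≤ 2 * ‖G (x + θ * Complex.I)‖ := by linarith
    refine ⟨norm_pos_iff.1 (by linarith), ?_, ?_⟩
    · nlinarith
    · nlinarith
  · rw [norm_mul, Complex.norm_I, one_mul, norm_mul, norm_mul, mul_comm C]
    gcongr
    exact hC θ
  · rw [hn, hn]
    simpa using hB0 θ hθ
  · have h1 : ∫ φ in 0..θ, ‖Complex.exp (-B (x + φ * Complex.I))‖ =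
        Real.exp (-(B (x + θ * Complex.I)).re) * ∫ φ in 0..θ,
          Real.exp ((B (x + θ * Complex.I)).re - (B (x + φ * Complex.I)).re) := by
      rw [← intervalIntegral.integral_const_mul]
      congr 1; ext φ
      rw [hn, ← Real.exp_add]; ring_nf
    rw [h1, hn]
    nlinarith [hint θ hθ, Real.exp_pos (-(B (x + θ * Complex.I)).re)]

lemma left_estimate (n : ℕ) {ε : ℝ} (hε : 0 < ε) (hε1 : ε ≤ 1) : ∀ᶠ x : ℝ in atBot,
    ∀ θ ∈ Icc 0 Real.pi, expMacdonald n (x + θ * Complex.I) ≠ 0 ∧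
      ‖deriv (expMacdonald n) (x + θ * Complex.I) + n * expMacdonald n (x + θ * Complex.I)‖ ≤
        ε * ‖expMacdonald n (x + θ * Complex.I)‖ ∧
      ‖Complex.exp (n * (θ * Complex.I)) * expMacdonald n (x + θ * Complex.I) -
        expMacdonald n x‖ ≤ ε * ‖expMacdonald n x‖ := by
  have hF := differentiable_expMacdonald n
  have e1 : ∀ᶠ x : ℝ in atBot, Real.exp (2 * x) * Real.pi ≤ ε / 24 := by
    have : Tendsto (fun x : ℝ => Real.exp (2 * x) * Real.pi) atBot (𝓝 (0 * Real.pi)) :=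
      (Real.tendsto_exp_atBot.comp (tendsto_id.const_mul_atBot two_pos)).mul_const _
    rw [zero_mul] at this
    exact this.eventually_le_const (by positivity)
  have e2 : ∀ᶠ x : ℝ in atBot, Real.exp x * macdonald (n - 1) (Real.exp x) ≤
      ε / 24 * macdonald n (Real.exp x) :=
    Real.tendsto_exp_atBot_nhdsGT.eventually
      (eventually_mul_macdonald_sub_one_le n (by positivity : 0 < ε / 24))
  filter_upwards [e1, e2] with x h1 h2 θ hθ
  have hE : Differentiable ℂ fun w : ℂ => Complex.exp (n * w) := by fun_prop
  have hEd (w : ℂ) : deriv (fun w : ℂ => Complex.exp (n * w)) w = n * Complex.exp (n * w) := by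
    rw [deriv_cexp (by fun_prop), deriv_const_mul _ differentiableAt_fun_id]; simp [mul_comm]
  have hGd (w : ℂ) : deriv (expMacdonald n * fun w : ℂ => Complex.exp (n * w)) w =
      (deriv (expMacdonald n) w + n * expMacdonald n w) * Complex.exp (n * w) := by
    rw [deriv_mul (hF w) (hE w), hEd]; ring
  have hGd2 (w : ℂ) : deriv (deriv (expMacdonald n * fun w : ℂ => Complex.exp (n * w))) w =
      (deriv (deriv (expMacdonald n)) w + 2 * n * deriv (expMacdonald n) w +
        n ^ 2 * expMacdonald n w) * Complex.exp (n * w) := by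
    rw [funext hGd]
    have := ((hF.deriv w).hasDerivAt.add ((hF w).hasDerivAt.const_mul (n:ℂ))).mul
      (hE w).hasDerivAt
    rw [hEd] at this
    refine this.deriv.trans ?_
    simp only [Pi.add_apply]; ring
  have hne (w : ℂ) := Complex.exp_ne_zero (n * w)
  have key := vertical_estimate (G := expMacdonald n * fun w : ℂ => Complex.exp (n * w))
    (B := fun w => 2 * n * w) (c := fun w => Complex.exp (2 * w)) (x := x)
    (C := Real.exp (2 * x)) (ε := ε) (hF.mul hE) (by fun_prop) (by fun_prop) (fun w => ?_)
    (fun θ => ?_) hε hε1 (fun θ hθ => ?_) (fun θ hθ => ?_) ?_ ?_ hθ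
  · obtain ⟨k1, k2, k3⟩ := key
    simp only [hGd, Pi.mul_apply, norm_mul] at k1 k2 k3
    refine ⟨left_ne_zero_of_mul k1, ?_, ?_⟩
    · rw [← mul_assoc] at k2
      exact le_of_mul_le_mul_right k2 (norm_pos_iff.2 (hne _))
    · refine le_of_mul_le_mul_right ?_ (norm_pos_iff.2 (hne x))
      rw [mul_assoc, ← norm_mul]
      refine (congrArg norm ?_).trans_le k3
      rw [mul_add, Complex.exp_add]; ring
  · rw [hGd2, hGd, deriv_deriv_expMacdonald, deriv_const_mul _ differentiableAt_fun_id]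
    simp only [deriv_id'', Pi.mul_apply, Complex.ofReal_natCast]
    ring
  · simp [Complex.norm_exp]
  · simp
  · simp only [Complex.mul_re, Complex.add_re, Complex.ofReal_re, Complex.ofReal_im, Complex.I_re,
      Complex.I_im, Complex.re_ofNat, Complex.im_ofNat, Complex.natCast_re, Complex.natCast_im,
      Complex.mul_im]
    simp only [mul_zero, zero_mul, sub_zero, add_zero, sub_self, Real.exp_zero,
      intervalIntegral.integral_const, smul_eq_mul, mul_one]
    exact (mul_le_mul_of_nonneg_left hθ.2 (Real.exp_pos _).le).trans h1
  · rw [hGd, Pi.mul_apply, norm_mul, norm_mul, ← mul_assoc]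
    refine mul_le_mul_of_nonneg_right ?_ (norm_nonneg _)
    rw [deriv_expMacdonald_eq_sub_one, expMacdonald_ofReal, expMacdonald_ofReal,
      ← Complex.ofReal_exp]
    have : -((n:ℝ):ℂ) * (macdonald n (Real.exp x)) - (Real.exp x) *
        (macdonald (n - 1) (Real.exp x)) + n * (macdonald n (Real.exp x)) =
        ((-(Real.exp x * macdonald (n - 1) (Real.exp x)) : ℝ) : ℂ) := by push_cast; ring
    rw [this, Complex.norm_real, Complex.norm_real, Real.norm_eq_abs, Real.norm_eq_abs, abs_neg,
      abs_of_pos (mul_pos (Real.exp_pos x) (macdonald_pos _ (Real.exp_pos x))),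
      abs_of_pos (macdonald_pos _ (Real.exp_pos x))]
    exact h2
  · rw [Pi.mul_apply, expMacdonald_ofReal]
    exact mul_ne_zero (Complex.ofReal_ne_zero.2 (macdonald_pos _ (Real.exp_pos x)).ne') (hne _)

lemma mul_sq_le_cos_sub_cos {φ θ : ℝ} (hφ : 0 ≤ φ) (h : φ ≤ θ) (hθ : θ ≤ Real.pi) :
    2 * (((θ - φ) / Real.pi) ^ 2) ≤ Real.cos φ - Real.cos θ := by
  have hpi := Real.pi_pos
  have h1 : Real.cos φ - Real.cos θ = 2 * Real.sin ((θ + φ) / 2) * Real.sin ((θ - φ) / 2) := by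
    rw [← neg_sub, Real.cos_sub_cos]; ring
  have hs : (θ - φ) / Real.pi ≤ Real.sin ((θ - φ) / 2) := by
    have := Real.mul_le_sin (x := (θ - φ) / 2) (by linarith) (by linarith)
    refine le_trans (le_of_eq ?_) this
    field_simp
  have hs2 : Real.sin ((θ - φ) / 2) ≤ Real.sin ((θ + φ) / 2) := by
    have : Real.sin ((θ + φ) / 2) - Real.sin ((θ - φ) / 2) =
        2 * Real.sin (φ / 2) * Real.cos (θ / 2) := by
      rw [Real.sin_sub_sin]; ring_nf
    have h1 := Real.sin_nonneg_of_nonneg_of_le_pi (x := φ / 2) (by linarith) (by linarith)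
    have h2 := Real.cos_nonneg_of_mem_Icc (x := θ / 2) ⟨by linarith, by linarith⟩
    nlinarith [mul_nonneg h1 h2]
  have h0 : 0 ≤ (θ - φ) / Real.pi := div_nonneg (by linarith) hpi.le
  rw [h1]
  nlinarith [mul_le_mul hs (hs.trans hs2) h0 (h0.trans hs)]

lemma integral_exp_neg_mul_sub_sq_le {a : ℝ} (ha : 0 < a) (θ : ℝ) (hθ : 0 ≤ θ) :
    ∫ φ in 0..θ, Real.exp (-a * (θ - φ) ^ 2) ≤ √(Real.pi / a) := by
  rw [intervalIntegral.integral_comp_sub_left (fun u => Real.exp (-a * u ^ 2)), sub_self, sub_zero,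
    intervalIntegral.integral_of_le hθ, ← integral_gaussian]
  exact setIntegral_le_integral (integrable_exp_neg_mul_sq ha)
    (ae_of_all _ fun u => (Real.exp_pos _).le)

lemma right_estimate (n : ℕ) {ε : ℝ} (hε : 0 < ε) (hε1 : ε ≤ 1) : ∀ᶠ x : ℝ in atTop,
    ∀ θ ∈ Icc 0 Real.pi, expMacdonald n (x + θ * Complex.I) ≠ 0 ∧
      ‖deriv (expMacdonald n) (x + θ * Complex.I) +
        (Complex.exp (x + θ * Complex.I) + 1 / 2) * expMacdonald n (x + θ * Complex.I)‖ ≤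
        ε * ‖expMacdonald n (x + θ * Complex.I)‖ ∧
      ‖Complex.exp (Complex.exp (x + θ * Complex.I) + (x + θ * Complex.I) / 2) *
          expMacdonald n (x + θ * Complex.I) -
        Complex.exp (Complex.exp x + x / 2) * expMacdonald n x‖ ≤
      ε * ‖Complex.exp (Complex.exp x + x / 2) * expMacdonald n x‖ := by
  have hF := differentiable_expMacdonald n
  set a : ℝ → ℝ := fun x => 4 * Real.exp x / Real.pi ^ 2 with ha
  have ha0 (x) : 0 < a x := by positivity
  have e1 : ∀ᶠ x : ℝ in atTop, |(n:ℝ) ^ 2 - 1 / 4| * √(Real.pi / a x) ≤ ε / 24 := by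
    have h1 : Tendsto (fun x => Real.pi / a x) atTop (𝓝 0) :=
      ((Real.tendsto_exp_atTop.const_mul_atTop four_pos).atTop_div_const
        (by positivity)).const_div_atTop _
    have h2 := ((Real.continuous_sqrt.tendsto 0).comp h1).const_mul |(n:ℝ) ^ 2 - 1 / 4|
    rw [Real.sqrt_zero, mul_zero] at h2
    exact h2.eventually_le_const (by positivity)
  have e2 : ∀ᶠ x : ℝ in atTop, (1 / 4 + (n:ℝ) ^ 2) / Real.exp x ≤ ε / 24 :=
    (Real.tendsto_exp_atTop.const_div_atTop _).eventually_le_const (by positivity)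
  have e3 : ∀ᶠ x : ℝ in atTop, 2 * (1 / 4 + (n:ℝ) ^ 2) ≤ Real.exp x :=
    Real.tendsto_exp_atTop.eventually_ge_atTop _
  filter_upwards [e1, e2, e3] with x h1 h2 h3 θ hθ
  set S : ℂ → ℂ := fun w => Complex.exp (Complex.exp w + w / 2) with hS
  have hSd (w : ℂ) : HasDerivAt S ((Complex.exp w + 1 / 2) * S w) w :=
    (((Complex.hasDerivAt_exp w).add ((hasDerivAt_id w).div_const 2)).cexp).congr_deriv
      (mul_comm _ _)
  have hE : Differentiable ℂ S := fun w => (hSd w).differentiableAt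
  have hGd (w : ℂ) : deriv (expMacdonald n * S) w =
      (deriv (expMacdonald n) w + (Complex.exp w + 1 / 2) * expMacdonald n w) * S w := by
    rw [deriv_mul (hF w) (hE w), (hSd w).deriv]; ring
  have hGd2 (w : ℂ) : deriv (deriv (expMacdonald n * S)) w =
      (deriv (deriv (expMacdonald n)) w + (2 * Complex.exp w + 1) * deriv (expMacdonald n) w +
        (Complex.exp w + (Complex.exp w + 1 / 2) ^ 2) * expMacdonald n w) * S w := by
    rw [funext hGd]
    have := ((hF.deriv w).hasDerivAt.add (((Complex.hasDerivAt_exp w).add_const (1 / 2 : ℂ)).mul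
      (hF w).hasDerivAt)).mul (hSd w)
    refine this.deriv.trans ?_
    simp only [Pi.add_apply, Pi.mul_apply]; ring
  have hne (w : ℂ) : S w ≠ 0 := Complex.exp_ne_zero _
  have hre (θ : ℝ) : (2 * Complex.exp (x + θ * Complex.I) + (x + θ * Complex.I)).re =
      2 * Real.exp x * Real.cos θ + x := by
    simp [Complex.exp_re]; ring
  have key := vertical_estimate (G := expMacdonald n * S)
    (B := fun w => 2 * Complex.exp w + w) (c := fun _ => (n:ℂ) ^ 2 - 1 / 4) (x := x)
    (C := |(n:ℝ) ^ 2 - 1 / 4|) (ε := ε) (hF.mul hE) (by fun_prop) (by fun_prop) (fun w => ?_)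
    (fun θ => ?_) hε hε1 (fun θ hθ => ?_) (fun θ hθ => ?_) ?_ ?_ hθ
  · obtain ⟨k1, k2, k3⟩ := key
    simp only [hGd, Pi.mul_apply] at k1 k2 k3
    refine ⟨left_ne_zero_of_mul k1, ?_, ?_⟩
    · rw [norm_mul, norm_mul, ← mul_assoc] at k2
      exact le_of_mul_le_mul_right k2 (norm_pos_iff.2 (hne _))
    · rwa [mul_comm (expMacdonald _ _), mul_comm (expMacdonald _ _)] at k3
  · have h3 : Complex.exp (2 * w) = Complex.exp w ^ 2 := by rw [← Complex.exp_nat_mul]; simp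
    have h4 : deriv (fun w => 2 * Complex.exp w + w) w = 2 * Complex.exp w + 1 :=
      (((Complex.hasDerivAt_exp w).const_mul 2).add (hasDerivAt_id w)).deriv
    rw [hGd2, hGd, deriv_deriv_expMacdonald, h4]
    simp only [Pi.mul_apply, Complex.ofReal_natCast, h3]
    ring
  · rw [← Real.norm_eq_abs, ← Complex.norm_real]; simp
  · have h := hre 0
    simp only [Complex.ofReal_zero, zero_mul, add_zero] at h
    rw [hre, h, Real.cos_zero]
    nlinarith [Real.cos_le_one θ, Real.exp_pos x]
  · refine (mul_le_mul_of_nonneg_left ?_ (abs_nonneg _)).trans h1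
    refine le_trans ?_ (integral_exp_neg_mul_sub_sq_le (ha0 x) θ hθ.1)
    refine intervalIntegral.integral_mono_on hθ.1 (Continuous.intervalIntegrable (by fun_prop) _ _)
      (Continuous.intervalIntegrable (by fun_prop) _ _) fun φ hφ => Real.exp_le_exp.2 ?_
    rw [hre, hre]
    have := mul_le_mul_of_nonneg_left (mul_sq_le_cos_sub_cos hφ.1 hφ.2 hθ.2) (Real.exp_pos x).le
    have h5 : -a x * (θ - φ) ^ 2 = -2 * (Real.exp x * (2 * ((θ - φ) / Real.pi) ^ 2)) := by
      simp only [ha]; field_simp; ring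
    rw [h5]; linarith
  · rw [hGd, Pi.mul_apply, norm_mul, norm_mul, ← mul_assoc]
    refine mul_le_mul_of_nonneg_right ?_ (norm_nonneg _)
    have hpos := macdonald_pos n (Real.exp_pos x)
    rw [deriv_expMacdonald_ofReal, expMacdonald_ofReal, ← Complex.ofReal_exp]
    have h6 := abs_macdonald_asymptotic (Nat.cast_nonneg n) (Real.exp_pos x) h3
    have h7 := h6.trans (mul_le_mul_of_nonneg_right h2 hpos.le)
    rw [← Real.norm_eq_abs, ← Complex.norm_real] at h7
    rw [Complex.norm_real (macdonald _ _), Real.norm_eq_abs, abs_of_pos hpos]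
    refine (congrArg norm ?_).trans_le h7
    push_cast; ring
  · rw [Pi.mul_apply, expMacdonald_ofReal]
    exact mul_ne_zero (Complex.ofReal_ne_zero.2 (macdonald_pos _ (Real.exp_pos x)).ne') (hne _)

lemma deriv_expMacdonald_conj (ν : ℝ) (w : ℂ) :
    deriv (expMacdonald ν) (conj w) = conj (deriv (expMacdonald ν) w) := by
  have h : conj ∘ expMacdonald ν ∘ conj = expMacdonald ν := by
    ext w; simp [expMacdonald_conj]
  have h2 := congrFun (deriv_conj_conj (f := expMacdonald ν)) w
  rw [h] at h2
  simp [h2]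

lemma logDeriv_expMacdonald_conj (ν : ℝ) (w : ℂ) :
    logDeriv (expMacdonald ν) (conj w) = conj (logDeriv (expMacdonald ν) w) := by
  rw [logDeriv_apply, logDeriv_apply, deriv_expMacdonald_conj, expMacdonald_conj, map_div₀]

lemma eventually_norm_logDeriv_expMacdonald_add_le_atBot (n : ℕ) {ε : ℝ} (hε : 0 < ε) :
    ∀ᶠ x : ℝ in atBot, ∀ θ ∈ Icc (-Real.pi) Real.pi, expMacdonald n (x + θ * Complex.I) ≠ 0 ∧
      ‖logDeriv (expMacdonald n) (x + θ * Complex.I) + n‖ ≤ ε := by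
  filter_upwards [left_estimate n (lt_min hε one_pos) (min_le_right _ _)] with x hx θ hθ
  have key (θ) (hθ : θ ∈ Icc 0 Real.pi) : expMacdonald n (x + θ * Complex.I) ≠ 0 ∧
      ‖logDeriv (expMacdonald n) (x + θ * Complex.I) + n‖ ≤ ε := by
    obtain ⟨h1, h2, -⟩ := hx θ hθ
    refine ⟨h1, ?_⟩
    rw [logDeriv_apply, div_add' _ _ _ h1, norm_div, div_le_iff₀ (norm_pos_iff.2 h1)]
    exact h2.trans (mul_le_mul_of_nonneg_right (min_le_left _ _) (norm_nonneg _))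
  rcases le_total 0 θ with h | h
  · exact key θ ⟨h, hθ.2⟩
  · obtain ⟨h1, h2⟩ := key (-θ) ⟨by linarith, by linarith [hθ.1]⟩
    have hc : (x:ℂ) + θ * Complex.I = conj ((x:ℂ) + (-θ : ℝ) * Complex.I) := by simp
    rw [hc, expMacdonald_conj, logDeriv_expMacdonald_conj]
    refine ⟨(map_ne_zero _).2 h1, ?_⟩
    rw [← Complex.norm_conj]
    simpa using h2

lemma eventually_norm_logDeriv_expMacdonald_add_le_atTop (n : ℕ) {ε : ℝ} (hε : 0 < ε) :
    ∀ᶠ x : ℝ in atTop, ∀ θ ∈ Icc (-Real.pi) Real.pi, expMacdonald n (x + θ * Complex.I) ≠ 0 ∧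
      ‖logDeriv (expMacdonald n) (x + θ * Complex.I) +
        (Complex.exp (x + θ * Complex.I) + 1 / 2)‖ ≤ ε := by
  filter_upwards [right_estimate n (lt_min hε one_pos) (min_le_right _ _)] with x hx θ hθ
  have key (θ) (hθ : θ ∈ Icc 0 Real.pi) : expMacdonald n (x + θ * Complex.I) ≠ 0 ∧
      ‖logDeriv (expMacdonald n) (x + θ * Complex.I) +
        (Complex.exp (x + θ * Complex.I) + 1 / 2)‖ ≤ ε := by
    obtain ⟨h1, h2, -⟩ := hx θ hθ
    refine ⟨h1, ?_⟩
    rw [logDeriv_apply, div_add' _ _ _ h1, norm_div, div_le_iff₀ (norm_pos_iff.2 h1)]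
    exact h2.trans (mul_le_mul_of_nonneg_right (min_le_left _ _) (norm_nonneg _))
  rcases le_total 0 θ with h | h
  · exact key θ ⟨h, hθ.2⟩
  · obtain ⟨h1, h2⟩ := key (-θ) ⟨by linarith, by linarith [hθ.1]⟩
    have hc : (x:ℂ) + θ * Complex.I = conj ((x:ℂ) + (-θ : ℝ) * Complex.I) := by simp
    rw [hc, expMacdonald_conj, logDeriv_expMacdonald_conj, Complex.exp_conj]
    refine ⟨(map_ne_zero _).2 h1, ?_⟩
    rw [← Complex.norm_conj]
    simpa [map_ofNat] using h2

lemma hasDerivAt_comp_ofReal_add {G : ℂ → ℂ} (hG : Differentiable ℂ G) (c : ℂ) (x : ℝ) :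
    HasDerivAt (fun x : ℝ => G (x + c)) (deriv G (x + c)) x :=
  ((hG _).hasDerivAt.comp_add_const (x:ℂ) c).comp_ofReal

lemma expMacdonald_ofReal_ne_zero (ν x : ℝ) : expMacdonald ν x ≠ 0 := by
  rw [expMacdonald_ofReal]
  exact Complex.ofReal_ne_zero.2 (macdonald_pos _ (Real.exp_pos x)).ne'

theorem expMacdonald_ne_zero_of_abs_im_le (n : ℕ) {w : ℂ} (hw : |w.im| ≤ Real.pi / 2) :
    expMacdonald n w ≠ 0 := by
  have hF := differentiable_expMacdonald n
  have key (x₀ θ : ℝ) (hθ : 0 < θ) (hθ2 : θ ≤ Real.pi / 2) :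
      expMacdonald n (x₀ + θ * Complex.I) ≠ 0 := by
    intro h0
    set u : ℝ → ℝ := fun x => (conj (expMacdonald n (x + θ * Complex.I)) *
      deriv (expMacdonald n) (x + θ * Complex.I)).im with hu
    have hud (x : ℝ) : HasDerivAt u (Real.exp (2 * x) * Real.sin (2 * θ) *
        ‖expMacdonald n (x + θ * Complex.I)‖ ^ 2) x := by
      have h1 := hasDerivAt_comp_ofReal_add hF (θ * Complex.I) x
      have h2 := hasDerivAt_comp_ofReal_add hF.deriv (θ * Complex.I) x
      have h3 := Complex.imCLM.hasFDerivAt.comp_hasDerivAt x (h1.star.mul h2)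
      refine h3.congr_deriv ?_
      have h4 : Complex.exp (2 * (x + θ * Complex.I)) = Real.exp (2 * x) *
          (Real.cos (2 * θ) + Real.sin (2 * θ) * Complex.I) := by
        rw [mul_add, Complex.exp_add, ← mul_assoc]
        push_cast
        rw [← Complex.exp_mul_I]
      simp only [deriv_deriv_expMacdonald, h4, Complex.imCLM_apply]
      rw [← Complex.normSq_eq_norm_sq, Complex.normSq_apply]
      have h5 : ((n:ℂ) ^ 2).im = 0 := by norm_cast
      simp [-Complex.ofReal_exp, -Complex.ofReal_sin, -Complex.ofReal_cos, h5]
      ring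
    have hmono : Monotone u := monotone_of_deriv_nonneg (fun x => (hud x).differentiableAt)
      fun x => by
        rw [(hud x).deriv]
        have := Real.sin_nonneg_of_nonneg_of_le_pi (x := 2 * θ) (by linarith) (by linarith)
        positivity
    have hs : 0 < Real.sin θ := Real.sin_pos_of_pos_of_lt_pi hθ (by linarith [Real.pi_pos])
    obtain ⟨x, hx, hx1, hx2⟩ := ((eventually_norm_logDeriv_expMacdonald_add_le_atTop n
      one_pos).and ((eventually_ge_atTop x₀).and
      ((Real.tendsto_exp_atTop.atTop_mul_const hs).eventually_gt_atTop 1))).exists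
    obtain ⟨h1, h2⟩ := hx θ ⟨by linarith [Real.pi_pos], by linarith [Real.pi_pos]⟩
    have h3 : 0 ≤ u x := by
      have : u x₀ = 0 := by simp [hu, h0]
      exact this ▸ hmono hx1
    have h4 : u x = ‖expMacdonald n (x + θ * Complex.I)‖ ^ 2 *
        (logDeriv (expMacdonald n) (x + θ * Complex.I)).im := by
      rw [← Complex.im_ofReal_mul, logDeriv_apply]
      simp only [hu]
      congr 1
      push_cast
      rw [← Complex.conj_mul']
      field_simp
    have h5 := (Complex.abs_im_le_norm _).trans h2
    rw [Complex.add_im, Complex.add_im, Complex.exp_im] at h5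
    simp at h5
    have h6 := (abs_le.1 h5).2
    have h7 : 0 < ‖expMacdonald n (x + θ * Complex.I)‖ ^ 2 := by positivity
    rw [h4] at h3
    have h8 := nonneg_of_mul_nonneg_right h3 h7
    linarith
  rcases lt_trichotomy w.im 0 with h | h | h
  · rw [abs_of_neg h] at hw
    have := key w.re (-w.im) (by linarith) hw
    have hc : (w.re:ℂ) + (-w.im : ℝ) * Complex.I = conj w := by
      apply Complex.ext <;> simp
    rw [hc, expMacdonald_conj] at this
    exact (map_ne_zero _).1 this
  · have hc : w = (w.re : ℂ) := by apply Complex.ext <;> simp [h]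
    rw [hc]
    exact expMacdonald_ofReal_ne_zero _ _
  · rw [abs_of_pos h] at hw
    have := key w.re w.im h hw
    rwa [Complex.re_add_im] at this

lemma expMacdonald_add_pi_mul_I_re (n : ℕ) (x : ℝ) :
    (expMacdonald n (x + Real.pi * Complex.I)).re = (-1) ^ n * macdonald n (Real.exp x) := by
  have h := expMacdonald_add_pi_mul_I_add_sub n x
  have hc : (x:ℂ) - Real.pi * Complex.I = conj ((x:ℂ) + Real.pi * Complex.I) := by
    simp [sub_eq_add_neg]
  rw [hc, expMacdonald_conj, Complex.add_conj, expMacdonald_ofReal] at h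
  have h2 : (2 * (expMacdonald n (x + Real.pi * Complex.I)).re : ℝ) =
    2 * (-1) ^ n * macdonald n (Real.exp x) := by exact_mod_cast h
  linarith

lemma expMacdonald_add_pi_mul_I_ne_zero (n : ℕ) (x : ℝ) :
    expMacdonald n (x + Real.pi * Complex.I) ≠ 0 := by
  intro h
  have := expMacdonald_add_pi_mul_I_re n x
  rw [h, Complex.zero_re] at this
  exact mul_ne_zero (pow_ne_zero _ (by norm_num)) (macdonald_pos n (Real.exp_pos x)).ne' this.symm

lemma analyticOrderAt_expMacdonald_ne_top (ν : ℝ) (w : ℂ) :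
    analyticOrderAt (expMacdonald ν) w ≠ ⊤ := by
  intro h
  rw [analyticOrderAt_eq_top] at h
  have hF : AnalyticOnNhd ℂ (expMacdonald ν) univ :=
    (differentiable_expMacdonald ν).differentiableOn.analyticOnNhd isOpen_univ
  have := hF.eqOn_zero_of_preconnected_of_eventuallyEq_zero isPreconnected_univ (mem_univ w) h
    (mem_univ ((0:ℝ):ℂ))
  exact expMacdonald_ofReal_ne_zero ν 0 this

theorem deriv_expMacdonald_ne_zero (ν : ℝ) {w : ℂ} (hw : expMacdonald ν w = 0) :
    deriv (expMacdonald ν) w ≠ 0 := by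
  intro hw'
  have hF := differentiable_expMacdonald ν
  have h1 := (hF.analyticAt w).analyticOrderAt_deriv_add_one
  have h2 := (hF.deriv.analyticAt w).analyticOrderAt_deriv_add_one
  have hc : Differentiable ℂ fun w : ℂ => Complex.exp (2 * w) + (ν:ℂ) ^ 2 := by fun_prop
  have h3 := analyticOrderAt_mul (hc.analyticAt w) (hF.analyticAt w)
  rw [show ((fun w : ℂ => Complex.exp (2 * w) + (ν:ℂ) ^ 2) * expMacdonald ν) =
    deriv (deriv (expMacdonald ν)) from (funext (deriv_deriv_expMacdonald ν)).symm] at h3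
  simp only [hw, hw', sub_zero] at h1 h2
  obtain ⟨m, hm⟩ := ENat.ne_top_iff_exists.1 (analyticOrderAt_expMacdonald_ne_top ν w)
  have h4 : analyticOrderAt (expMacdonald ν) w + 1 + 1 ≤ analyticOrderAt (expMacdonald ν) w := by
    refine le_trans ?_ h1.le
    refine le_trans ?_ (add_le_add_left h2.le 1)
    rw [h3]
    gcongr
    exact le_add_self
  rw [← hm] at h4
  norm_cast at h4
  omega

/-- The closed rectangle with corners `±A ± πi`. -/
def stripRect (A : ℝ) : Set ℂ := Icc (-A) A ×ℂ Icc (-Real.pi) Real.pi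

/-- The open rectangle with corners `±A ± πi`. -/
def stripRectInterior (A : ℝ) : Set ℂ := Ioo (-A) A ×ℂ Ioo (-Real.pi) Real.pi

/-- The counterclockwise integral over the boundary of the rectangle with corners `±A ± πi`. -/
noncomputable def stripIntegral (f : ℂ → ℂ) (A : ℝ) : ℂ :=
  (∫ x in -A..A, f (x - Real.pi * Complex.I)) - (∫ x in -A..A, f (x + Real.pi * Complex.I)) +
    Complex.I * (∫ y in -Real.pi..Real.pi, f (A + y * Complex.I)) -
    Complex.I * ∫ y in -Real.pi..Real.pi, f (-A + y * Complex.I)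

lemma bottom_mem_stripRect_diff {A x : ℝ} (hx : x ∈ Icc (-A) A) :
    (x - Real.pi * Complex.I : ℂ) ∈ stripRect A \ stripRectInterior A := by
  simp [stripRect, stripRectInterior, Complex.mem_reProdIm, hx.1, hx.2, Real.pi_pos.le]

lemma top_mem_stripRect_diff {A x : ℝ} (hx : x ∈ Icc (-A) A) :
    (x + Real.pi * Complex.I : ℂ) ∈ stripRect A \ stripRectInterior A := by
  simp [stripRect, stripRectInterior, Complex.mem_reProdIm, hx.1, hx.2, Real.pi_pos.le]

lemma right_mem_stripRect_diff {A y : ℝ} (hA : 0 ≤ A) (hy : y ∈ Icc (-Real.pi) Real.pi) :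
    (A + y * Complex.I : ℂ) ∈ stripRect A \ stripRectInterior A := by
  simp [stripRect, stripRectInterior, Complex.mem_reProdIm, hy.1, hy.2, hA]

lemma left_mem_stripRect_diff {A y : ℝ} (hA : 0 ≤ A) (hy : y ∈ Icc (-Real.pi) Real.pi) :
    (-A + y * Complex.I : ℂ) ∈ stripRect A \ stripRectInterior A := by
  simp [stripRect, stripRectInterior, Complex.mem_reProdIm, hy.1, hy.2, hA]

lemma stripIntegral_congr {f g : ℂ → ℂ} {A : ℝ} (hA : 0 ≤ A)
    (h : ∀ w ∈ stripRect A \ stripRectInterior A, f w = g w) :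
    stripIntegral f A = stripIntegral g A := by
  have hA' : -A ≤ A := by linarith
  have hp : -Real.pi ≤ Real.pi := by linarith [Real.pi_pos]
  unfold stripIntegral
  congr 1
  · congr 1
    · congr 1 <;> refine intervalIntegral.integral_congr fun x hx => h _ ?_ <;>
        rw [uIcc_of_le hA'] at hx
      · exact bottom_mem_stripRect_diff hx
      · exact top_mem_stripRect_diff hx
    · congr 1
      refine intervalIntegral.integral_congr fun y hy => h _ ?_
      rw [uIcc_of_le hp] at hy
      exact right_mem_stripRect_diff hA hy
  · congr 1
    refine intervalIntegral.integral_congr fun y hy => h _ ?_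
    rw [uIcc_of_le hp] at hy
    exact left_mem_stripRect_diff hA hy

lemma stripIntegral_add {f g : ℂ → ℂ} {A : ℝ} (hA : 0 ≤ A)
    (hf : ContinuousOn f (stripRect A \ stripRectInterior A))
    (hg : ContinuousOn g (stripRect A \ stripRectInterior A)) :
    stripIntegral (fun w => f w + g w) A = stripIntegral f A + stripIntegral g A := by
  have hA' : -A ≤ A := by linarith
  have hp : -Real.pi ≤ Real.pi := by linarith [Real.pi_pos]
  have hi {h : ℂ → ℂ} (hh : ContinuousOn h (stripRect A \ stripRectInterior A)) {p : ℝ → ℂ}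
      {a b : ℝ} (hab : a ≤ b) (hp : Continuous p)
      (hm : ∀ x ∈ Icc a b, p x ∈ stripRect A \ stripRectInterior A) :
      IntervalIntegrable (fun x => h (p x)) volume a b :=
    (hh.comp hp.continuousOn fun x hx => hm x (by rwa [uIcc_of_le hab] at hx)).intervalIntegrable
  have m1 (x) (hx : x ∈ Icc (-A) A) := bottom_mem_stripRect_diff hx
  have m2 (x) (hx : x ∈ Icc (-A) A) := top_mem_stripRect_diff hx
  have m3 (y) (hy : y ∈ Icc (-Real.pi) Real.pi) := right_mem_stripRect_diff hA hy
  have m4 (y) (hy : y ∈ Icc (-Real.pi) Real.pi) := left_mem_stripRect_diff hA hy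
  unfold stripIntegral
  rw [intervalIntegral.integral_add (hi hf hA' (by fun_prop) m1) (hi hg hA' (by fun_prop) m1),
    intervalIntegral.integral_add (hi hf hA' (by fun_prop) m2) (hi hg hA' (by fun_prop) m2),
    intervalIntegral.integral_add (hi hf hp (by fun_prop) m3) (hi hg hp (by fun_prop) m3),
    intervalIntegral.integral_add (hi hf hp (by fun_prop) m4) (hi hg hp (by fun_prop) m4)]
  ring

lemma stripIntegral_eq_zero {f : ℂ → ℂ} {A : ℝ} (hA : 0 ≤ A)
    (hf : DifferentiableOn ℂ f (stripRect A)) : stripIntegral f A = 0 := by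
  have := Complex.integral_boundary_rect_eq_zero_of_differentiableOn f ⟨-A, -Real.pi⟩ ⟨A, Real.pi⟩
    (by rwa [uIcc_of_le (by linarith : -A ≤ A),
      uIcc_of_le (by linarith [Real.pi_pos] : -Real.pi ≤ Real.pi)])
  simpa [stripIntegral, sub_eq_add_neg] using this

lemma differentiableOn_logDeriv {H : ℂ → ℂ} (hH : Differentiable ℂ H) {s : Set ℂ}
    (hs : ∀ w ∈ s, H w ≠ 0) : DifferentiableOn ℂ (logDeriv H) s := fun w hw =>
  ((hH.deriv w).div (hH w) (hs w hw)).differentiableWithinAt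

lemma integral_exp_div_exp_sub (a : ℝ) (z : ℂ) :
    Complex.I * ∫ y in -Real.pi..Real.pi, Complex.exp (a + y * Complex.I) /
      (Complex.exp (a + y * Complex.I) - z) = ∮ ζ in C(0, Real.exp a), (ζ - z)⁻¹ := by
  have hper : Function.Periodic (fun y : ℝ => Complex.exp (a + y * Complex.I) /
      (Complex.exp (a + y * Complex.I) - z)) (2 * Real.pi) := fun y => by
    have : (a:ℂ) + (y + 2 * Real.pi : ℝ) * Complex.I =
        a + y * Complex.I + 2 * Real.pi * Complex.I := by push_cast; ring
    simp only [this, Complex.exp_periodic _]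
  have h := hper.intervalIntegral_add_eq (-Real.pi) 0
  rw [show -Real.pi + 2 * Real.pi = Real.pi by ring, zero_add] at h
  rw [h, circleIntegral, ← intervalIntegral.integral_const_mul]
  congr 1; ext y
  simp only [deriv_circleMap, circleMap, zero_add, smul_eq_mul, Complex.exp_add,
    Complex.ofReal_exp]
  ring

lemma stripIntegral_exp_div_exp_sub {A : ℝ} {z : ℂ} (h1 : Real.exp (-A) < ‖z‖)
    (h2 : ‖z‖ < Real.exp A) :
    stripIntegral (fun w => Complex.exp w / (Complex.exp w - z)) A = 2 * Real.pi * Complex.I := by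
  have e (x : ℝ) : Complex.exp (x - Real.pi * Complex.I) = Complex.exp (x + Real.pi * Complex.I) := by
    rw [Complex.exp_sub, Complex.exp_add, Complex.exp_pi_mul_I]; ring
  unfold stripIntegral
  have hA := integral_exp_div_exp_sub A z
  have hA' := integral_exp_div_exp_sub (-A) z
  rw [Complex.ofReal_neg] at hA'
  simp only [e]
  rw [hA, hA', circleIntegral.integral_sub_inv_of_mem_ball (by simpa using h2),
    Complex.circleIntegral_eq_zero_of_differentiable_on_off_countable (Real.exp_pos _).le
      countable_empty]
  · ring
  · intro ζ hζ
    have : ‖ζ‖ ≤ Real.exp (-A) := by simpa using hζ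
    exact ContinuousAt.continuousWithinAt (ContinuousAt.inv₀ (by fun_prop)
      (sub_ne_zero.2 fun h => by rw [h] at this; linarith))
  · intro ζ hζ
    have : ‖ζ‖ < Real.exp (-A) := by simpa using hζ
    exact DifferentiableAt.inv (by fun_prop) (sub_ne_zero.2 fun h => by rw [h] at this; linarith)

lemma Differentiable.dslope {f : ℂ → ℂ} (hf : Differentiable ℂ f) (c : ℂ) :
    Differentiable ℂ (dslope f c) := by
  rw [← differentiableOn_univ] at hf ⊢
  exact (Complex.differentiableOn_dslope univ_mem).2 hf

lemma dslope_exp_ne_zero {w₀ w : ℂ} (h : |(w - w₀).im| < 2 * Real.pi) :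
    dslope Complex.exp w₀ w ≠ 0 := by
  rcases eq_or_ne w w₀ with rfl | hne
  · rw [dslope_same, Complex.deriv_exp]; exact Complex.exp_ne_zero _
  · rw [dslope_of_ne _ hne, slope_def_field]
    refine div_ne_zero (sub_ne_zero.2 fun he => ?_) (sub_ne_zero.2 hne)
    obtain ⟨k, hk⟩ := Complex.exp_eq_exp_iff_exists_int.1 he
    have hk2 : w - w₀ = k * (2 * Real.pi * Complex.I) := by rw [hk]; ring
    have h3 : (w - w₀).im = k * (2 * Real.pi) := by rw [hk2]; simp
    rw [h3, abs_mul, abs_of_pos Real.two_pi_pos] at h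
    have h4 : |(k:ℝ)| < 1 := by
      by_contra! hc
      nlinarith [Real.two_pi_pos]
    have h5 : k = 0 := Int.abs_lt_one_iff.1 (by exact_mod_cast h4)
    rw [h5] at hk2
    simp [sub_eq_zero] at hk2
    exact hne hk2

lemma logDeriv_eq_inv_add_logDeriv_dslope {F : ℂ → ℂ} (hF : Differentiable ℂ F) {w₀ w : ℂ}
    (hne : w ≠ w₀) (hFw : F w ≠ F w₀) :
    deriv F w / (F w - F w₀) = (w - w₀)⁻¹ + logDeriv (dslope F w₀) w := by
  have h1 (w) : F w - F w₀ = (w - w₀) * dslope F w₀ w := by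
    rw [← smul_eq_mul, sub_smul_dslope]
  have h2 : deriv F w = dslope F w₀ w + (w - w₀) * deriv (dslope F w₀) w := by
    have h3 : F = fun w => (w - w₀) * dslope F w₀ w + F w₀ := by
      ext w; rw [← h1]; ring
    have h4 := ((((hasDerivAt_id w).sub_const w₀).mul (hF.dslope w₀ w).hasDerivAt).add_const
      (F w₀)).deriv
    nth_rewrite 1 [h3]
    refine h4.trans ?_
    simp
  have h5 : dslope F w₀ w ≠ 0 := by
    intro h
    have := h1 w
    rw [h, mul_zero, sub_eq_zero] at this
    exact hFw this
  rw [logDeriv_apply, h1, h2]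
  have := sub_ne_zero.2 hne
  field_simp

lemma stripIntegral_inv_sub {A : ℝ} {w₀ : ℂ} (hw : w₀ ∈ stripRectInterior A) :
    stripIntegral (fun w => (w - w₀)⁻¹) A = 2 * Real.pi * Complex.I := by
  obtain ⟨⟨hw1 : -A < w₀.re, hw2 : w₀.re < A⟩, hw3 : -Real.pi < w₀.im, hw4 : w₀.im < Real.pi⟩ := hw
  have hA : 0 ≤ A := by linarith
  have him {w : ℂ} (hw : w ∈ stripRect A) : |(w - w₀).im| < 2 * Real.pi := by
    obtain ⟨-, h1 : -Real.pi ≤ w.im, h2 : w.im ≤ Real.pi⟩ := hw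
    rw [Complex.sub_im, abs_lt]; constructor <;> linarith
  have hH := Complex.differentiable_exp.dslope w₀
  have hld := differentiableOn_logDeriv hH (s := stripRect A) fun w hw => dslope_exp_ne_zero (him hw)
  have hne {w : ℂ} (hw : w ∈ stripRect A \ stripRectInterior A) : w ≠ w₀ := fun h =>
    hw.2 (h ▸ ⟨⟨hw1, hw2⟩, hw3, hw4⟩)
  have h1 := stripIntegral_exp_div_exp_sub (A := A) (z := Complex.exp w₀)
    (by rw [Complex.norm_exp]; exact Real.exp_lt_exp.2 hw1)
    (by rw [Complex.norm_exp]; exact Real.exp_lt_exp.2 hw2)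
  rw [stripIntegral_congr (g := fun w => (w - w₀)⁻¹ + logDeriv (dslope Complex.exp w₀) w) hA
    fun w hw => ?_, stripIntegral_add hA ?_ (hld.continuousOn.mono sdiff_subset),
    stripIntegral_eq_zero hA hld, add_zero] at h1
  · exact h1
  · exact ContinuousOn.inv₀ (by fun_prop) fun w hw => sub_ne_zero.2 (hne hw)
  · have h3 := logDeriv_eq_inv_add_logDeriv_dslope Complex.differentiable_exp (hne hw) (w₀ := w₀)
      (fun he => by
        have h4 := dslope_exp_ne_zero (him hw.1)
        rw [dslope_of_ne _ (hne hw), slope_def_field, he, sub_self, zero_div] at h4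
        exact h4 rfl)
    rwa [Complex.deriv_exp] at h3

/-- The argument principle on the rectangle with corners `±A ± πi`, for simple zeros. -/
theorem stripIntegral_logDeriv {A : ℝ} (hA : 0 ≤ A) (Z : Finset ℂ)
    (hZ : ∀ w ∈ Z, w ∈ stripRectInterior A) {F : ℂ → ℂ} (hF : Differentiable ℂ F)
    (h0 : ∀ w ∈ stripRect A, F w = 0 ↔ w ∈ Z) (h1 : ∀ w ∈ Z, deriv F w ≠ 0) :
    stripIntegral (logDeriv F) A = 2 * Real.pi * Complex.I * Z.card := by
  induction Z using Finset.induction_on generalizing F with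
  | empty =>
    rw [stripIntegral_eq_zero hA (differentiableOn_logDeriv hF fun w hw => by simpa using (h0 w hw).not)]
    simp
  | insert w₀ Z hw₀ ih =>
    have hsub : stripRectInterior A ⊆ stripRect A := fun w hw =>
      ⟨Ioo_subset_Icc_self hw.1, Ioo_subset_Icc_self hw.2⟩
    have hw₀m := hZ w₀ (Finset.mem_insert_self _ _)
    have hFw₀ : F w₀ = 0 := (h0 w₀ (hsub hw₀m)).2 (Finset.mem_insert_self _ _)
    have hH := hF.dslope w₀
    have hmul (w) : F w = (w - w₀) * dslope F w₀ w := by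
      rw [← smul_eq_mul, sub_smul_dslope, hFw₀, sub_zero]
    have hHw₀ : dslope F w₀ w₀ ≠ 0 := by
      rw [dslope_same]; exact h1 _ (Finset.mem_insert_self _ _)
    have hderiv (w : ℂ) : deriv F w = dslope F w₀ w + (w - w₀) * deriv (dslope F w₀) w := by
      have h4 := (((hasDerivAt_id w).sub_const w₀).mul (hH w).hasDerivAt).deriv
      nth_rewrite 1 [funext hmul]
      refine h4.trans ?_
      simp
    have hne {w : ℂ} (hw : w ∈ stripRect A \ stripRectInterior A) : w ≠ w₀ := fun h =>
      hw.2 (h ▸ hw₀m)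
    have hHZ (w) (hw : w ∈ stripRect A) : dslope F w₀ w = 0 ↔ w ∈ Z := by
      rcases eq_or_ne w w₀ with rfl | hne
      · simp only [hHw₀, hw₀]
      · have := h0 w hw
        rw [hmul, mul_eq_zero, Finset.mem_insert] at this
        simpa [hne, sub_eq_zero] using this
    have hih := ih (fun w hw => hZ w (Finset.mem_insert_of_mem hw)) hH hHZ (fun w hw h => by
      have h2 := h1 w (Finset.mem_insert_of_mem hw)
      rw [hderiv, h, (hHZ w (hsub (hZ w (Finset.mem_insert_of_mem hw)))).2 hw] at h2
      simp at h2)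
    have hHb (w) (hw : w ∈ stripRect A \ stripRectInterior A) : dslope F w₀ w ≠ 0 := fun h =>
      hw.2 (hZ w (Finset.mem_insert_of_mem ((hHZ w hw.1).1 h)))
    rw [stripIntegral_congr (g := fun w => (w - w₀)⁻¹ + logDeriv (dslope F w₀) w) hA
      fun w hw => ?_, stripIntegral_add hA ?_ (differentiableOn_logDeriv hH hHb).continuousOn, hih,
      stripIntegral_inv_sub hw₀m, Finset.card_insert_of_notMem hw₀]
    · push_cast; ring
    · exact ContinuousOn.inv₀ (by fun_prop) fun w hw => sub_ne_zero.2 (hne hw)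
    · have h2 := hHb w hw
      have h3 := sub_ne_zero.2 (hne hw)
      rw [logDeriv_apply, logDeriv_apply, hderiv, hmul]
      field_simp

lemma HasDerivAt.arctan_im_div_re {f : ℝ → ℂ} {f' : ℂ} {x : ℝ} (hf : HasDerivAt f f' x)
    (h : (f x).re ≠ 0) :
    HasDerivAt (fun x => Real.arctan ((f x).im / (f x).re)) (f' / f x).im x := by
  have h1 := Complex.reCLM.hasFDerivAt.comp_hasDerivAt x hf
  have h2 := Complex.imCLM.hasFDerivAt.comp_hasDerivAt x hf
  refine ((h2.div h1 h).arctan).congr_deriv ?_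
  simp only [Function.comp_apply, Complex.reCLM_apply, Complex.imCLM_apply, Pi.div_apply,
    Complex.div_im, Complex.normSq_apply]
  have h3 : 0 < (f x).re * (f x).re + (f x).im * (f x).im := by
    have := mul_self_pos.2 h
    nlinarith [mul_self_nonneg (f x).im]
  have h4 : 1 + ((f x).im / (f x).re) ^ 2 =
      ((f x).re * (f x).re + (f x).im * (f x).im) / (f x).re ^ 2 := by field_simp
  rw [h4]
  field_simp

lemma tendsto_im_div_re_expMacdonald_atBot (n : ℕ) :
    Tendsto (fun x : ℝ => (expMacdonald n (x + Real.pi * Complex.I)).im /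
      (expMacdonald n (x + Real.pi * Complex.I)).re) atBot (𝓝 0) := by
  rw [Metric.tendsto_nhds]
  intro ε hε
  filter_upwards [left_estimate n (ε := min (ε / 2) 1) (by positivity) (min_le_right _ _)] with x hx
  have h := (hx Real.pi (right_mem_Icc.2 Real.pi_pos.le)).2.2
  have hpos := macdonald_pos n (Real.exp_pos x)
  have e1 : Complex.exp (n * (Real.pi * Complex.I)) = ((-1) ^ n : ℝ) := by
    rw [Complex.exp_nat_mul, Complex.exp_pi_mul_I]; norm_cast
  rw [e1, expMacdonald_ofReal, Complex.norm_real, Real.norm_eq_abs, abs_of_pos hpos] at h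
  have h2 := (Complex.abs_im_le_norm _).trans h
  rw [Complex.sub_im, Complex.ofReal_im, sub_zero, Complex.im_ofReal_mul, abs_mul, abs_pow, abs_neg,
    abs_one, one_pow, one_mul] at h2
  rw [dist_zero_right, Real.norm_eq_abs, abs_div, expMacdonald_add_pi_mul_I_re, abs_mul, abs_pow,
    abs_neg, abs_one, one_pow, one_mul, abs_of_pos hpos, div_lt_iff₀ hpos]
  have h3 := mul_le_mul_of_nonneg_right (min_le_left (ε / 2) 1) hpos.le
  nlinarith

lemma tendsto_im_div_macdonald_atTop (n : ℕ) :
    Tendsto (fun x : ℝ => (expMacdonald n (x + Real.pi * Complex.I)).im /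
      macdonald n (Real.exp x)) atTop atBot := by
  have h0 : Tendsto (fun x : ℝ => -(1 / 2 * Real.exp (2 * Real.exp x))) atTop atBot :=
    tendsto_neg_atTop_atBot.comp ((Real.tendsto_exp_atTop.comp
      (Real.tendsto_exp_atTop.const_mul_atTop two_pos)).const_mul_atTop (by norm_num))
  refine tendsto_atBot_mono' _ ?_ h0
  filter_upwards [right_estimate n (ε := 1 / 2) (by norm_num) (by norm_num)] with x hx
  have h := (hx Real.pi (right_mem_Icc.2 Real.pi_pos.le)).2.2
  have hpos := macdonald_pos n (Real.exp_pos x)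
  have e1 : Complex.exp (Complex.exp (x + Real.pi * Complex.I) + (x + Real.pi * Complex.I) / 2) =
      (Real.exp (-Real.exp x + x / 2) : ℝ) * Complex.I := by
    have : Complex.exp (x + Real.pi * Complex.I) + (x + Real.pi * Complex.I) / 2 =
        ((-Real.exp x + x / 2 : ℝ) : ℂ) + Real.pi / 2 * Complex.I := by
      rw [Complex.exp_add, Complex.exp_pi_mul_I]; push_cast; ring
    rw [this, Complex.exp_add, Complex.exp_pi_div_two_mul_I, Complex.ofReal_exp]
  have e2 : Complex.exp (Complex.exp x + x / 2) * expMacdonald n x =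
      (Real.exp (Real.exp x + x / 2) * macdonald n (Real.exp x) : ℝ) := by
    rw [expMacdonald_ofReal]; push_cast; rfl
  rw [e1, e2, Complex.norm_real, Real.norm_eq_abs, abs_of_pos (mul_pos (Real.exp_pos _) hpos)] at h
  have h2 := (Complex.abs_re_le_norm _).trans h
  rw [Complex.sub_re, Complex.ofReal_re, mul_assoc, Complex.re_ofReal_mul, Complex.I_mul_re] at h2
  have h3 := (abs_le.1 h2).1
  rw [div_le_iff₀ hpos]
  have e3 : Real.exp (Real.exp x + x / 2) =
      Real.exp (2 * Real.exp x) * Real.exp (-Real.exp x + x / 2) := by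
    rw [← Real.exp_add]; ring_nf
  rw [e3] at h3
  refine le_of_mul_le_mul_left ?_ (Real.exp_pos (-Real.exp x + x / 2))
  linarith

lemma tendsto_arctan_im_div_re_expMacdonald_atTop (n : ℕ) :
    Tendsto (fun x : ℝ => Real.arctan ((expMacdonald n (x + Real.pi * Complex.I)).im /
      (expMacdonald n (x + Real.pi * Complex.I)).re)) atTop (𝓝 (-((-1) ^ n * (Real.pi / 2)))) := by
  have h := (Real.tendsto_arctan_atBot.mono_right nhdsWithin_le_nhds).comp
    (tendsto_im_div_macdonald_atTop n)
  have h2 := h.const_mul ((-1) ^ n)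
  rw [mul_neg] at h2
  refine h2.congr fun x => ?_
  rw [expMacdonald_add_pi_mul_I_re, Function.comp_apply]
  rcases neg_one_pow_eq_or ℝ n with h | h <;> rw [h]
  · simp
  · simp [div_neg, Real.arctan_neg]

lemma continuous_logDeriv_expMacdonald_top (n : ℕ) :
    Continuous fun x : ℝ => logDeriv (expMacdonald n) (x + Real.pi * Complex.I) := by
  have hF := differentiable_expMacdonald n
  have h1 := hF.continuous
  have h2 := hF.deriv.continuous
  simp only [logDeriv_apply]
  exact Continuous.div (by fun_prop) (by fun_prop) fun x => expMacdonald_add_pi_mul_I_ne_zero n x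

lemma tendsto_integral_logDeriv_expMacdonald_top (n : ℕ) :
    Tendsto (fun A : ℝ => ∫ x in -A..A,
      (logDeriv (expMacdonald n) (x + Real.pi * Complex.I)).im) atTop
      (𝓝 (-((-1) ^ n * (Real.pi / 2)))) := by
  have h1 := tendsto_arctan_im_div_re_expMacdonald_atTop n
  have h2 := ((Real.continuous_arctan.tendsto 0).comp
    (tendsto_im_div_re_expMacdonald_atBot n)).comp tendsto_neg_atTop_atBot
  have h3 := h1.sub h2
  have hc : Continuous fun x : ℝ => (logDeriv (expMacdonald n) (x + Real.pi * Complex.I)).im :=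
    Complex.continuous_im.comp (continuous_logDeriv_expMacdonald_top n)
  rw [Real.arctan_zero, sub_zero] at h3
  refine h3.congr fun A => ?_
  symm
  refine intervalIntegral.integral_eq_sub_of_hasDerivAt (f := fun x : ℝ => Real.arctan
    ((expMacdonald n (x + Real.pi * Complex.I)).im /
      (expMacdonald n (x + Real.pi * Complex.I)).re)) (fun x _ => ?_) (hc.intervalIntegrable _ _)
  refine (hasDerivAt_comp_ofReal_add (differentiable_expMacdonald n)
    (Real.pi * Complex.I) x).arctan_im_div_re ?_
  rw [expMacdonald_add_pi_mul_I_re]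
  exact mul_ne_zero (pow_ne_zero _ (by norm_num)) (macdonald_pos n (Real.exp_pos x)).ne'

lemma integral_logDeriv_expMacdonald_bottom_sub_top (n : ℕ) (A : ℝ) :
    (∫ x in -A..A, logDeriv (expMacdonald n) (x - Real.pi * Complex.I)) -
      (∫ x in -A..A, logDeriv (expMacdonald n) (x + Real.pi * Complex.I)) =
      -2 * Complex.I * (∫ x in -A..A,
        (logDeriv (expMacdonald n) (x + Real.pi * Complex.I)).im : ℝ) := by
  have hc := continuous_logDeriv_expMacdonald_top n
  have e (x : ℝ) : logDeriv (expMacdonald n) (x - Real.pi * Complex.I) =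
      conj (logDeriv (expMacdonald n) (x + Real.pi * Complex.I)) := by
    rw [← logDeriv_expMacdonald_conj]
    simp [sub_eq_add_neg]
  simp only [e]
  have hc' : Continuous fun x : ℝ => conj (logDeriv (expMacdonald n) (x + Real.pi * Complex.I)) :=
    Complex.continuous_conj.comp hc
  rw [← intervalIntegral.integral_sub (hc'.intervalIntegrable _ _)
    (hc.intervalIntegrable _ _), ← intervalIntegral.integral_ofReal,
    ← intervalIntegral.integral_const_mul]
  congr 1; ext x
  rw [← neg_sub, Complex.sub_conj]
  push_cast; ring

lemma tendsto_integral_of_eventually_norm_sub_le {l : Filter ℝ} {f g : ℝ → ℝ → ℂ} {a b : ℝ} {c : ℂ}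
    (hab : a ≤ b) (hf : ∀ᶠ x in l, ContinuousOn (f x) (Icc a b)) (hg : ∀ x, Continuous (g x))
    (hgc : ∀ x, ∫ y in a..b, g x y = c)
    (h : ∀ ε > 0, ∀ᶠ x in l, ∀ y ∈ Icc a b, ‖f x y - g x y‖ ≤ ε) :
    Tendsto (fun x => ∫ y in a..b, f x y) l (𝓝 c) := by
  rw [Metric.tendsto_nhds]
  intro ε hε
  have hba : 0 ≤ b - a := sub_nonneg.2 hab
  filter_upwards [hf, h (ε / (b - a + 1)) (by positivity)] with x hx1 hx2
  rw [dist_eq_norm, ← hgc x, ← intervalIntegral.integral_sub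
    (ContinuousOn.intervalIntegrable (by rwa [uIcc_of_le hab])) ((hg x).intervalIntegrable _ _)]
  have h1 := intervalIntegral.norm_integral_le_of_norm_le_const (f := fun y => f x y - g x y)
    (a := a) (b := b) (C := ε / (b - a + 1)) fun y hy => by
      rw [uIoc_of_le hab] at hy
      exact hx2 y (Ioc_subset_Icc_self hy)
  refine h1.trans_lt ?_
  rw [abs_of_nonneg hba, div_mul_eq_mul_div, div_lt_iff₀ (by positivity)]
  nlinarith

lemma continuousOn_logDeriv_vertical {F : ℂ → ℂ} (hF : Differentiable ℂ F) {x a b : ℝ}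
    (h : ∀ θ ∈ Icc a b, F (x + θ * Complex.I) ≠ 0) :
    ContinuousOn (fun θ : ℝ => logDeriv F (x + θ * Complex.I)) (Icc a b) := by
  have h1 := hF.continuous
  have h2 := hF.deriv.continuous
  simp only [logDeriv_apply]
  exact ContinuousOn.div (by fun_prop) (by fun_prop) h

lemma integral_exp_add_mul_I (x : ℝ) :
    ∫ y in -Real.pi..Real.pi, Complex.exp (x + y * Complex.I) = 0 := by
  have h := intervalIntegral.integral_eq_sub_of_hasDerivAt (a := -Real.pi) (b := Real.pi)
    (fun θ _ => hasDerivAt_comp_add_mul_I Complex.differentiable_exp x θ)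
    (Continuous.intervalIntegrable (by rw [Complex.deriv_exp]; fun_prop) _ _)
  simp only [Complex.deriv_exp] at h
  rw [intervalIntegral.integral_const_mul, Complex.ofReal_neg, neg_mul, ← sub_eq_add_neg,
    Complex.exp_add, Complex.exp_sub, Complex.exp_pi_mul_I, div_neg, div_one, mul_neg_one,
    sub_self] at h
  exact (mul_eq_zero.1 h).resolve_left Complex.I_ne_zero

lemma tendsto_integral_logDeriv_expMacdonald_right (n : ℕ) :
    Tendsto (fun A : ℝ => ∫ y in -Real.pi..Real.pi, logDeriv (expMacdonald n) (A + y * Complex.I))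
      atTop (𝓝 (-Real.pi)) := by
  refine tendsto_integral_of_eventually_norm_sub_le
    (g := fun A y => -(Complex.exp (A + y * Complex.I) + 1 / 2)) (by linarith [Real.pi_pos]) ?_
    (fun x => by fun_prop) (fun x => ?_) fun ε hε => ?_
  · filter_upwards [eventually_norm_logDeriv_expMacdonald_add_le_atTop n one_pos] with x hx
    exact continuousOn_logDeriv_vertical (differentiable_expMacdonald n) fun θ hθ => (hx θ hθ).1
  · rw [intervalIntegral.integral_neg, intervalIntegral.integral_add
      (Continuous.intervalIntegrable (by fun_prop) _ _)
      (Continuous.intervalIntegrable (by fun_prop) _ _), integral_exp_add_mul_I,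
      intervalIntegral.integral_const]
    rw [Complex.real_smul]; push_cast; ring
  · filter_upwards [eventually_norm_logDeriv_expMacdonald_add_le_atTop n hε] with x hx θ hθ
    rw [sub_neg_eq_add]
    exact (hx θ hθ).2

lemma tendsto_integral_logDeriv_expMacdonald_left (n : ℕ) :
    Tendsto (fun A : ℝ => ∫ y in -Real.pi..Real.pi, logDeriv (expMacdonald n) (-A + y * Complex.I))
      atTop (𝓝 (-(2 * Real.pi * n))) := by
  have h : Tendsto (fun x : ℝ => ∫ y in -Real.pi..Real.pi,
      logDeriv (expMacdonald n) (x + y * Complex.I)) atBot (𝓝 (-(2 * Real.pi * n))) := by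
    refine tendsto_integral_of_eventually_norm_sub_le
      (g := fun _ _ => -(n:ℂ)) (by linarith [Real.pi_pos]) ?_
      (fun x => by fun_prop) (fun x => ?_) fun ε hε => ?_
    · filter_upwards [eventually_norm_logDeriv_expMacdonald_add_le_atBot n one_pos] with x hx
      exact continuousOn_logDeriv_vertical (differentiable_expMacdonald n) fun θ hθ => (hx θ hθ).1
    · rw [intervalIntegral.integral_const, Complex.real_smul]; push_cast; ring
    · filter_upwards [eventually_norm_logDeriv_expMacdonald_add_le_atBot n hε] with x hx θ hθ
      rw [sub_neg_eq_add]
      exact (hx θ hθ).2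
  refine (h.comp tendsto_neg_atTop_atBot).congr fun A => ?_
  simp

lemma natCast_Mn (n : ℕ) : (2 * (Mn n : ℂ)) = 2 * n + (-1) ^ n - 1 := by
  unfold Mn
  split_ifs with h
  · rw [h.neg_one_pow]; ring
  · rw [Nat.not_even_iff_odd] at h
    rw [h.neg_one_pow, Nat.cast_sub h.pos]; push_cast; ring

theorem tendsto_stripIntegral_logDeriv_expMacdonald (n : ℕ) :
    Tendsto (stripIntegral (logDeriv (expMacdonald n))) atTop
      (𝓝 (2 * Real.pi * Complex.I * Mn n)) := by
  have h1 := ((Complex.continuous_ofReal.tendsto _).comp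
    (tendsto_integral_logDeriv_expMacdonald_top n)).const_mul (-2 * Complex.I)
  have h2 := (tendsto_integral_logDeriv_expMacdonald_right n).const_mul Complex.I
  have h3 := (tendsto_integral_logDeriv_expMacdonald_left n).const_mul Complex.I
  convert (h1.add h2).sub h3 using 1
  · ext A
    rw [stripIntegral, integral_logDeriv_expMacdonald_bottom_sub_top]; rfl
  · congr 1
    push_cast
    linear_combination Real.pi * Complex.I * natCast_Mn n

lemma exists_expMacdonald_ne_zero_of_le_abs_re (n : ℕ) : ∃ A : ℝ, 0 ≤ A ∧
    ∀ w : ℂ, A ≤ |w.re| → |w.im| ≤ Real.pi → expMacdonald n w ≠ 0 := by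
  obtain ⟨A, hA⟩ := eventually_atTop.1
    (eventually_norm_logDeriv_expMacdonald_add_le_atTop n one_pos)
  obtain ⟨B, hB⟩ := eventually_atBot.1
    (eventually_norm_logDeriv_expMacdonald_add_le_atBot n one_pos)
  refine ⟨max 0 (max A (-B)), le_max_left _ _, fun w h1 h2 => ?_⟩
  rw [max_le_iff, max_le_iff] at h1
  rw [← Complex.re_add_im w]
  rcases le_total 0 w.re with h | h
  · rw [abs_of_nonneg h] at h1
    exact (hA _ h1.2.1 _ (abs_le.1 h2)).1
  · rw [abs_of_nonpos h] at h1
    exact (hB _ (by linarith) _ (abs_le.1 h2)).1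

lemma Differentiable.finite_zeros_of_isCompact {F : ℂ → ℂ} (hF : Differentiable ℂ F)
    (hord : ∀ w, analyticOrderAt F w ≠ ⊤) {S : Set ℂ} (hS : IsCompact S) :
    {w | w ∈ S ∧ F w = 0}.Finite := by
  by_contra hinf
  obtain ⟨z, -, hz⟩ := Set.Infinite.exists_accPt_of_subset_isCompact hinf hS fun w hw => hw.1
  rw [accPt_iff_frequently_nhdsNE] at hz
  have h2 : ∃ᶠ w in 𝓝[≠] z, F w = 0 := hz.mono fun w hw => hw.2
  exact hord z (analyticOrderAt_eq_top.2 ((hF.analyticAt z).frequently_zero_iff_eventually_zero.1 h2))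

theorem finite_and_ncard_zeros_expMacdonald (n : ℕ) :
    {w : ℂ | |w.im| < Real.pi ∧ expMacdonald n w = 0}.Finite ∧
      {w : ℂ | |w.im| < Real.pi ∧ expMacdonald n w = 0}.ncard = Mn n := by
  have hF := differentiable_expMacdonald n
  obtain ⟨A₀, hA₀, hne⟩ := exists_expMacdonald_ne_zero_of_le_abs_re n
  have hfin : {w : ℂ | |w.im| < Real.pi ∧ expMacdonald n w = 0}.Finite := by
    refine (hF.finite_zeros_of_isCompact (analyticOrderAt_expMacdonald_ne_top n)
      (isCompact_Icc.reProdIm isCompact_Icc : IsCompact (stripRect A₀))).subset ?_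
    rintro w ⟨h1, h2⟩
    refine ⟨⟨abs_le.1 ?_, abs_le.1 h1.le⟩, h2⟩
    by_contra! h3
    exact hne w h3.le h1.le h2
  refine ⟨hfin, ?_⟩
  have hlim : Tendsto (stripIntegral (logDeriv (expMacdonald n))) atTop
      (𝓝 (2 * Real.pi * Complex.I * hfin.toFinset.card)) := by
    refine tendsto_const_nhds.congr' ?_
    filter_upwards [eventually_ge_atTop A₀] with A hA
    refine (stripIntegral_logDeriv (hA₀.trans hA) _ (fun w hw => ?_) hF (fun w hw => ?_)
      (fun w hw => ?_)).symm
    · obtain ⟨h1, h2⟩ := hfin.mem_toFinset.1 hw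
      refine ⟨abs_lt.1 ?_, abs_lt.1 h1⟩
      by_contra! h3
      exact hne w (hA.trans h3) h1.le h2
    · rw [hfin.mem_toFinset]
      refine ⟨fun h => ⟨lt_of_le_of_ne (abs_le.2 hw.2) fun h1 => ?_, h⟩, fun h => h.2⟩
      rcases (abs_eq Real.pi_pos.le).1 h1 with h2 | h2
      · refine expMacdonald_add_pi_mul_I_ne_zero n w.re ?_
        rwa [← h2, Complex.re_add_im]
      · refine expMacdonald_add_pi_mul_I_ne_zero n w.re ?_
        have : (w.re : ℂ) + Real.pi * Complex.I = conj w := by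
          apply Complex.ext <;> simp [h2]
        rw [this, expMacdonald_conj, h, map_zero]
    · exact deriv_expMacdonald_ne_zero _ (hfin.mem_toFinset.1 hw).2
  have h := tendsto_nhds_unique hlim (tendsto_stripIntegral_logDeriv_expMacdonald n)
  rw [Set.ncard_eq_toFinset_card _ hfin]
  exact_mod_cast mul_left_cancel₀ Complex.two_pi_I_ne_zero h

lemma zeros_eq_image_exp {n : ℕ} {K : ℂ → ℂ} (hK : AnalyticOnNhd ℂ K Complex.slitPlane)
    (hKval : ∀ x : ℝ, 0 < x → K (x : ℂ) = (besselK n x : ℂ)) :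
    {z : ℂ | z ∈ Complex.slitPlane ∧ K z = 0} =
      Complex.exp '' {w : ℂ | |w.im| < Real.pi ∧ expMacdonald n w = 0} := by
  ext z
  constructor
  · rintro ⟨hz, h⟩
    refine ⟨Complex.log z, ⟨?_, ?_⟩, Complex.exp_log (Complex.slitPlane_ne_zero hz)⟩
    · rw [Complex.log_im]
      exact lt_of_le_of_ne (Complex.abs_arg_le_pi z) fun h => by
        rcases (abs_eq Real.pi_pos.le).1 h with h | h
        · exact Complex.slitPlane_arg_ne_pi hz h
        · exact (Complex.neg_pi_lt_arg z).ne' h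
    · rw [← eq_expMacdonald_log hK hKval hz, h]
  · rintro ⟨w, ⟨h1, h2⟩, rfl⟩
    obtain ⟨h3, h4⟩ := abs_lt.1 h1
    have hlog := Complex.log_exp h3 h4.le
    have hs : Complex.exp w ∈ Complex.slitPlane := by
      rw [Complex.mem_slitPlane_iff_arg, ← Complex.log_im, hlog]
      exact ⟨h4.ne, Complex.exp_ne_zero _⟩
    exact ⟨hs, by rw [eq_expMacdonald_log hK hKval hs, hlog, h2]⟩

lemma injOn_exp_strip (F : ℂ → ℂ) :
    InjOn Complex.exp {w : ℂ | |w.im| < Real.pi ∧ F w = 0} := by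
  rintro w ⟨hw, -⟩ v ⟨hv, -⟩ h
  rw [abs_lt] at hw hv
  exact Complex.exp_inj_of_neg_pi_lt_of_le_pi hw.1 hw.2.le hv.1 hv.2.le h

end

/-- the analytic continuation of `K_n` has exactly `M_n` zeros in the slit
plane (counted with multiplicity), all simple, with strictly negative real part and
nonzero imaginary part, and the zero set is closed under conjugation. -/
theorem stmt_1 (n : ℕ) (K : ℂ → ℂ)
    (hK : AnalyticOnNhd ℂ K Complex.slitPlane)
    (hKval : ∀ x : ℝ, 0 < x → K (x : ℂ) = (besselK n x : ℂ)) :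
    {z : ℂ | z ∈ Complex.slitPlane ∧ K z = 0}.Finite ∧
    {z : ℂ | z ∈ Complex.slitPlane ∧ K z = 0}.ncard = Mn n ∧
    (∀ z ∈ Complex.slitPlane, K z = 0 →
      deriv K z ≠ 0 ∧ z.re < 0 ∧ z.im ≠ 0 ∧ K ((starRingEnd ℂ) z) = 0) := by
  obtain ⟨hfin, hcard⟩ := finite_and_ncard_zeros_expMacdonald n
  have hlog {z : ℂ} (hz : z ∈ Complex.slitPlane) := eq_expMacdonald_log hK hKval hz
  refine ⟨?_, ?_, fun z hz h => ?_⟩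
  · rw [zeros_eq_image_exp hK hKval]
    exact hfin.image _
  · rw [zeros_eq_image_exp hK hKval, (injOn_exp_strip _).ncard_image, hcard]
  · have h0 : expMacdonald n (Complex.log z) = 0 := by rw [← hlog hz, h]
    have hre : z.re < 0 := by
      by_contra! hre
      refine expMacdonald_ne_zero_of_abs_im_le n ?_ h0
      rw [Complex.log_im]
      exact Complex.abs_arg_le_pi_div_two_iff.2 hre
    refine ⟨?_, hre, ?_, ?_⟩
    · have hd : HasDerivAt K (deriv (expMacdonald n) (Complex.log z) * z⁻¹) z :=
        ((differentiable_expMacdonald n _).hasDerivAt.comp z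
          (Complex.hasDerivAt_log hz)).congr_of_eventuallyEq
          (Filter.eventually_of_mem (Complex.isOpen_slitPlane.mem_nhds hz) fun y hy => hlog hy)
      rw [hd.deriv]
      exact mul_ne_zero (deriv_expMacdonald_ne_zero _ h0) (inv_ne_zero (Complex.slitPlane_ne_zero hz))
    · exact (Complex.mem_slitPlane_iff.1 hz).resolve_left hre.not_gt
    · have hz' : (starRingEnd ℂ) z ∈ Complex.slitPlane := by
        simpa [Complex.mem_slitPlane_iff] using hz
      rw [hlog hz', Complex.log_conj _ (Complex.slitPlane_arg_ne_pi hz), expMacdonald_conj, h0,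
        map_zero]
end

section
/- Let n ≥ 0 be an integer and let z_1,…,z_n be the roots of p_n (the zeros of K_{n+1/2}). Then for every z in the slit plane ℂ∖(−∞,0] with p_n(z) ≠ 0, one has the partial-fraction identity z + 1/2 + z·K_{n+1/2}'(z)/K_{n+1/2}(z) = Σ_{j=1}^n z_j/(z − z_j). Consequently, for any b, c > 0 and every s ∈ ℂ with Re(s) > 0, the Laplace transform of σ_{n+1/2} satisfies L[σ_{n+1/2}](s) = s/c + 1/(2b) + (s/c)·K_{n+1/2}'(s b/c)/K_{n+1/2}(s b/c). -/
open MeasureTheory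

/-- The coefficient `(n+k)!/(k!(n-k)!)` of the reversed Bessel polynomial, extended by zero. -/
noncomputable def besselCoeff (n k : ℕ) : ℂ :=
  if k ≤ n then ((n + k).factorial : ℂ) / ((k.factorial : ℂ) * ((n - k).factorial : ℂ)) else 0

lemma pPoly_eval (n : ℕ) (z : ℂ) :
    (pPoly n).eval z = ∑ k ∈ Finset.range (n + 1), besselCoeff n k * (2 * z) ^ (n - k) := by
  simp only [pPoly, Polynomial.eval_finsetSum]
  refine Finset.sum_congr rfl fun k hk => ?_
  rw [besselCoeff, if_pos (Nat.lt_succ_iff.mp (Finset.mem_range.mp hk))]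
  simp

lemma besselCoeff_zero (n : ℕ) : besselCoeff n 0 = 1 := by
  have : (n.factorial : ℂ) ≠ 0 := Nat.cast_ne_zero.mpr n.factorial_ne_zero
  simp [besselCoeff, this]

lemma besselCoeff_of_lt {n k : ℕ} (h : n < k) : besselCoeff n k = 0 :=
  if_neg (not_le.mpr h)

lemma besselCoeff_rec {n k : ℕ} (hk : k ≤ n + 1) :
    besselCoeff (n + 2) (k + 1)
      = 2 * (2 * n + 3) * besselCoeff (n + 1) k + besselCoeff n (k + 1) := by
  have hf (m : ℕ) : (m.factorial : ℂ) ≠ 0 := Nat.cast_ne_zero.mpr m.factorial_ne_zero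
  have hk0 : (k : ℂ) + 1 ≠ 0 := Nat.cast_add_one_ne_zero k
  rcases Nat.lt_or_ge k n with h | h
  · obtain ⟨m, rfl⟩ : ∃ m, n = k + 1 + m := ⟨n - (k + 1), by omega⟩
    have hm1 : (m : ℂ) + 1 ≠ 0 := Nat.cast_add_one_ne_zero m
    have hm2 : (m : ℂ) + 1 + 1 ≠ 0 := by exact_mod_cast Nat.succ_ne_zero (m + 1)
    have h1 := hf (k + k + m)
    have h2 := hf k
    have h3 := hf m
    rw [besselCoeff, besselCoeff, besselCoeff, if_pos (by omega), if_pos (by omega),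
      if_pos (by omega),
      show k + 1 + m + 2 + (k + 1) = k + k + m + 1 + 1 + 1 + 1 by ring,
      show k + 1 + m + 1 + k = k + k + m + 1 + 1 by ring,
      show k + 1 + m + (k + 1) = k + k + m + 1 + 1 by ring,
      show k + 1 + m + 2 - (k + 1) = m + 1 + 1 by omega,
      show k + 1 + m + 1 - k = m + 1 + 1 by omega,
      show k + 1 + m - (k + 1) = m by omega]
    simp only [Nat.factorial_succ, Nat.cast_mul, Nat.cast_add, Nat.cast_one]
    field_simp
    ring
  · rw [besselCoeff_of_lt (show n < k + 1 by omega), besselCoeff, besselCoeff,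
      if_pos (by omega), if_pos hk]
    have h2 := hf k
    obtain rfl | rfl : k = n ∨ k = n + 1 := by omega
    · rw [show k + 2 + (k + 1) = k + 1 + k + 1 + 1 by ring,
        show k + 2 - (k + 1) = 1 by omega, show k + 1 - k = 1 by omega]
      simp only [Nat.factorial_succ k, Nat.factorial_succ (k + 1 + k + 1),
        Nat.factorial_succ (k + 1 + k), Nat.factorial_one, Nat.cast_mul, Nat.cast_add, Nat.cast_one]
      field_simp
      ring
    · rw [show n + 2 + (n + 1 + 1) = n + 1 + (n + 1) + 1 + 1 by ring,
        show n + 2 - (n + 1 + 1) = 0 by omega, Nat.sub_self]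
      push_cast at hk0
      simp only [Nat.factorial_succ (n + 1), Nat.factorial_succ (n + 1 + (n + 1) + 1),
        Nat.factorial_succ (n + 1 + (n + 1)), Nat.factorial_zero, Nat.cast_mul, Nat.cast_add,
        Nat.cast_one]
      field_simp
      ring

lemma pPoly_eval_rec (n : ℕ) (z : ℂ) :
    (pPoly (n + 2)).eval z
      = 2 * (2 * n + 3) * (pPoly (n + 1)).eval z + (2 * z) ^ 2 * (pPoly n).eval z := by
  have key : (2 * z) ^ 2 * (pPoly n).eval z
      = ∑ k ∈ Finset.range (n + 3), besselCoeff n k * (2 * z) ^ (n + 2 - k) := by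
    rw [pPoly_eval, Finset.sum_range_succ _ (n + 2), Finset.sum_range_succ _ (n + 1),
      besselCoeff_of_lt (show n < n + 2 by omega), besselCoeff_of_lt (show n < n + 1 by omega),
      Finset.mul_sum]
    simp only [zero_mul, add_zero]
    refine Finset.sum_congr rfl fun k hk => ?_
    rw [show n + 2 - k = n - k + 2 by have := Finset.mem_range.mp hk; omega, pow_add]
    ring
  rw [key, pPoly_eval, pPoly_eval, Finset.sum_range_succ' _ (n + 2),
    Finset.sum_range_succ' _ (n + 2), besselCoeff_zero, besselCoeff_zero, ← add_assoc,
    Finset.mul_sum, ← Finset.sum_add_distrib]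
  congr 1
  refine Finset.sum_congr rfl fun k hk => ?_
  rw [besselCoeff_rec (by have := Finset.mem_range.mp hk; omega),
    show n + 2 - (k + 1) = n + 1 - k by omega]
  ring

lemma inv_re_pos {w : ℂ} (hw : 0 < w.re) : 0 < w⁻¹.re := by
  have hw0 : w ≠ 0 := fun h => by simp [h] at hw
  rw [Complex.inv_re]
  exact div_pos hw (Complex.normSq_pos.mpr hw0)

/-- In the right half-plane, `p_n` does not vanish and `p_{n+1} / (2 z p_n)` has positive real
part. -/
lemma pPoly_ratio_re_pos {z : ℂ} (hz : 0 < z.re) (n : ℕ) :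
    (pPoly n).eval z ≠ 0 ∧ 0 < ((pPoly (n + 1)).eval z / (2 * z * (pPoly n).eval z)).re := by
  have hz0 : z ≠ 0 := fun h => by simp [h] at hz
  induction n with
  | zero =>
    have h0 : (pPoly 0).eval z = 1 := by simp [pPoly]
    have h1 : (pPoly 1).eval z = 2 * z + 2 := by
      simp [pPoly, Finset.sum_range_succ]
    refine ⟨by simp [h0], ?_⟩
    simp only [zero_add, h0, h1]
    rw [show (2 * z + 2) / (2 * z * 1) = 1 + z⁻¹ by field_simp, Complex.add_re, Complex.one_re]
    have := inv_re_pos hz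
    positivity
  | succ n ih =>
    obtain ⟨hn, hr⟩ := ih
    have hn1 : (pPoly (n + 1)).eval z ≠ 0 := fun h => by simp [h] at hr
    refine ⟨hn1, ?_⟩
    rw [pPoly_eval_rec, show (2 * (2 * n + 3) * (pPoly (n + 1)).eval z
        + (2 * z) ^ 2 * (pPoly n).eval z) / (2 * z * (pPoly (n + 1)).eval z)
        = ((2 * n + 3 : ℝ) : ℂ) * z⁻¹
          + ((pPoly (n + 1)).eval z / (2 * z * (pPoly n).eval z))⁻¹ by
        push_cast; field_simp, Complex.add_re, Complex.re_ofReal_mul]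
    have h1 := inv_re_pos hz
    have h2 := inv_re_pos hr
    positivity

lemma Khalf_eq_pPoly (n : ℕ) {z : ℂ} (hz : z ≠ 0) :
    Khalf n z = ((Real.pi : ℂ) / (2 * z)) ^ ((1 : ℂ) / 2) * Complex.exp (-z)
      * ((pPoly n).eval z / (2 * z) ^ n) := by
  rw [Khalf, pPoly_eval, Finset.sum_div]
  congr 1
  refine Finset.sum_congr rfl fun k hk => ?_
  have hk' : k ≤ n := Nat.lt_succ_iff.mp (Finset.mem_range.mp hk)
  have h2z : 2 * z ≠ 0 := mul_ne_zero two_ne_zero hz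
  rw [besselCoeff, if_pos hk', ← div_div, div_eq_div_iff (pow_ne_zero _ h2z) (pow_ne_zero _ h2z),
    mul_assoc, ← pow_add, Nat.sub_add_cancel hk']

lemma pi_div_two_mul_mem_slitPlane {z : ℂ} (hz : z ∈ Complex.slitPlane) :
    (Real.pi : ℂ) / (2 * z) ∈ Complex.slitPlane := by
  have hz0 := Complex.slitPlane_ne_zero hz
  have hN : 0 < Complex.normSq z := Complex.normSq_pos.mpr hz0
  have hpi := Real.pi_pos
  rw [show (Real.pi : ℂ) / (2 * z) = ((Real.pi / 2 : ℝ) : ℂ) * z⁻¹ by push_cast; field_simp,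
    Complex.mem_slitPlane_iff, Complex.re_ofReal_mul, Complex.im_ofReal_mul, Complex.inv_re,
    Complex.inv_im]
  rcases Complex.mem_slitPlane_iff.mp hz with h | h
  · exact Or.inl (by positivity)
  · exact Or.inr (mul_ne_zero (by positivity) (div_ne_zero (neg_ne_zero.mpr h) hN.ne'))

lemma mul_logDeriv_Khalf (n : ℕ) {z : ℂ} (hz : z ∈ Complex.slitPlane)
    (hp : (pPoly n).eval z ≠ 0) :
    z * deriv (Khalf n) z / Khalf n z
      = -(1 / 2) - z - n + z * ((pPoly n).derivative.eval z / (pPoly n).eval z) := by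
  have hz0 := Complex.slitPlane_ne_zero hz
  have h2z : 2 * z ≠ 0 := mul_ne_zero two_ne_zero hz0
  have hmem := pi_div_two_mul_mem_slitPlane hz
  have hg0 := Complex.slitPlane_ne_zero hmem
  have hg : HasDerivAt (fun w : ℂ => (Real.pi : ℂ) / (2 * w)) (-((Real.pi : ℂ) / (2 * z)) / z) z := by
    refine ((hasDerivAt_const z (Real.pi : ℂ)).div ((hasDerivAt_id z).const_mul 2)
      h2z).congr_deriv ?_
    simp only [id]
    field_simp
    ring
  have hf := hg.cpow_const (c := 1 / 2) hmem
  have he : HasDerivAt (fun w : ℂ => Complex.exp (-w)) (Complex.exp (-z) * (-1)) z :=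
    (hasDerivAt_neg z).cexp
  have hq := ((pPoly n).hasDerivAt z).div (((hasDerivAt_id z).const_mul (2 : ℂ)).pow n)
    (pow_ne_zero n h2z)
  have hprod := (hf.mul he).mul hq
  have heq : Khalf n =ᶠ[nhds z] fun w => ((Real.pi : ℂ) / (2 * w)) ^ ((1 : ℂ) / 2)
      * Complex.exp (-w) * ((pPoly n).eval w / (2 * w) ^ n) := by
    filter_upwards [isOpen_ne.mem_nhds hz0] with w hw using Khalf_eq_pPoly n hw
  have hK := (hprod.congr_of_eventuallyEq heq).deriv
  have hcp : ((Real.pi : ℂ) / (2 * z)) ^ ((1 : ℂ) / 2) ≠ 0 := by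
    rw [Ne, Complex.cpow_eq_zero_iff]
    exact fun h => hg0 h.1
  rw [hK, Khalf_eq_pPoly n hz0]
  simp only [Pi.mul_apply, Pi.div_apply, Pi.pow_apply, id]
  rw [Complex.cpow_sub _ _ hg0, Complex.cpow_one]
  generalize ((Real.pi : ℂ) / (2 * z)) ^ ((1 : ℂ) / 2) = A at hcp ⊢
  have hE := Complex.exp_ne_zero (-z)
  generalize Complex.exp (-z) = E at hE ⊢
  generalize (Real.pi : ℂ) / (2 * z) = G at hg0 ⊢
  have hpow : (n : ℂ) * (2 * z) ^ (n - 1) = n * (2 * z) ^ n / (2 * z) := by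
    cases n with
    | zero => simp
    | succ m => rw [Nat.add_sub_cancel, pow_succ]; field_simp
  rw [hpow]
  have hP := pow_ne_zero n h2z
  generalize (2 * z) ^ n = P at hP ⊢
  field_simp
  ring

lemma khalf_partial_fractions (n : ℕ) (Z : Fin n → ℂ)
    (hZ : (pPoly n).roots = ↑(List.ofFn Z)) {z : ℂ} (hz : z ∈ Complex.slitPlane)
    (hp : (pPoly n).eval z ≠ 0) :
    z + 1/2 + z * deriv (Khalf n) z / Khalf n z = ∑ j, Z j / (z - Z j) := by
  have hne (j : Fin n) : z - Z j ≠ 0 := by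
    have hmem : Z j ∈ (pPoly n).roots := by
      rw [hZ, Multiset.mem_coe, List.mem_ofFn]
      exact ⟨j, rfl⟩
    intro h
    rw [sub_eq_zero.mp h] at hp
    exact hp (Polynomial.isRoot_of_mem_roots hmem)
  rw [mul_logDeriv_Khalf n hz hp,
    (IsAlgClosed.splits (pPoly n)).eval_derivative_div_eval_of_ne_zero hp, hZ, Multiset.map_coe,
    Multiset.sum_coe, List.map_ofFn, List.sum_ofFn]
  have hsum : ∑ j, Z j / (z - Z j) = z * ∑ j, 1 / (z - Z j) - n := by
    rw [Finset.mul_sum, eq_sub_iff_add_eq,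
      show (n : ℂ) = ∑ _j : Fin n, (1 : ℂ) by simp, ← Finset.sum_add_distrib]
    refine Finset.sum_congr rfl fun j _ => ?_
    have := hne j
    field_simp
    ring
  rw [hsum]
  simp only [Function.comp_apply]
  ring

lemma laplace_sigma3 {n : ℕ} (Z : Fin n → ℂ) (hre : ∀ j, (Z j).re ≤ 0) {b c : ℝ} (hb : 0 < b)
    (hc : 0 < c) {s : ℂ} (hs : 0 < s.re) :
    laplace (sigma3 b c Z) s = 1 / (b : ℂ) * ∑ j, Z j / (s * b / c - Z j) := by
  have hb0 : (b : ℂ) ≠ 0 := Complex.ofReal_ne_zero.mpr hb.ne'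
  have hc0 : (c : ℂ) ≠ 0 := Complex.ofReal_ne_zero.mpr hc.ne'
  have hare (j : Fin n) : (-s + ((c / b : ℝ) : ℂ) * Z j).re < 0 := by
    rw [Complex.add_re, Complex.neg_re, Complex.re_ofReal_mul]
    have := mul_nonpos_of_nonneg_of_nonpos (div_pos hc hb).le (hre j)
    linarith
  have hfun : (fun t : ℝ => Complex.exp (-s * t) * sigma3 b c Z t) = fun t : ℝ =>
      ∑ j, (c : ℂ) / (b : ℂ) ^ 2 * Z j * Complex.exp ((-s + ((c / b : ℝ) : ℂ) * Z j) * t) := by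
    funext t
    rw [sigma3, Finset.mul_sum, Finset.mul_sum]
    refine Finset.sum_congr rfl fun j _ => ?_
    rw [show (-s + ((c / b : ℝ) : ℂ) * Z j) * t = -s * t + (c : ℂ) * t * Z j / b by
      push_cast; ring, Complex.exp_add]
    ring
  rw [laplace, hfun, integral_finsetSum _ fun j _ =>
    (integrableOn_exp_mul_complex_Ioi (hare j) 0).const_mul _, Finset.mul_sum]
  refine Finset.sum_congr rfl fun j _ => ?_
  have ha0 : -s + ((c / b : ℝ) : ℂ) * Z j ≠ 0 := fun h => by
    have := hare j
    rw [h] at this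
    simp at this
  have hden : s * b / c - Z j ≠ 0 := by
    intro h
    apply ha0
    rw [← sub_eq_zero.mp h]
    push_cast
    field_simp
    ring
  rw [integral_const_mul, integral_exp_mul_complex_Ioi (hare j),
    show -s + ((c / b : ℝ) : ℂ) * Z j = -((c : ℂ) / b) * (s * b / c - Z j) by
      push_cast; field_simp; ring]
  simp only [Complex.ofReal_zero, mul_zero, Complex.exp_zero]
  generalize s * b / c - Z j = d at hden ⊢
  field_simp

/-- partial-fraction identity for the logarithmic derivative of `K_{n+1/2}`,
and the Laplace transform of the 3-D nonreflecting boundary kernel `σ_{n+1/2}`. -/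
theorem stmt_2 (n : ℕ) (Z : Fin n → ℂ)
    (hZ : (pPoly n).roots = ↑(List.ofFn Z)) :
    (∀ z ∈ Complex.slitPlane, (pPoly n).eval z ≠ 0 →
      z + 1/2 + z * deriv (Khalf n) z / Khalf n z = ∑ j, Z j / (z - Z j)) ∧
    (∀ b c : ℝ, 0 < b → 0 < c → ∀ s : ℂ, 0 < s.re →
      laplace (sigma3 b c Z) s
        = s/(c:ℂ) + 1/(2*(b:ℂ))
          + (s/(c:ℂ)) * deriv (Khalf n) (s*b/c) / Khalf n (s*b/c)) := by
  refine ⟨fun z hz hp => khalf_partial_fractions n Z hZ hz hp, fun b c hb hc s hs => ?_⟩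
  have hb0 : (b : ℂ) ≠ 0 := Complex.ofReal_ne_zero.mpr hb.ne'
  have hc0 : (c : ℂ) ≠ 0 := Complex.ofReal_ne_zero.mpr hc.ne'
  have hre (j : Fin n) : (Z j).re ≤ 0 := by
    by_contra! h
    have hmem : Z j ∈ (pPoly n).roots := by
      rw [hZ, Multiset.mem_coe, List.mem_ofFn]
      exact ⟨j, rfl⟩
    exact (pPoly_ratio_re_pos h n).1 (Polynomial.isRoot_of_mem_roots hmem)
  have hw : 0 < (s * b / c).re := by
    rw [Complex.div_ofReal_re, Complex.re_mul_ofReal]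
    positivity
  rw [laplace_sigma3 Z hre hb hc hs, ← khalf_partial_fractions n Z hZ
    (Complex.mem_slitPlane_iff.mpr (Or.inl hw)) (pPoly_ratio_re_pos hw n).1]
  field_simp
end
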